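/- Let p>1, ω>0, α₀ = 2/√((p−1)ω), and fix a smooth function χ : ℝ → [0,1] with χ = 1 on [−2,2] and χ = 0 outside (−3,3). For 0<ε<1 and ρ>0 set c = ω + (ερ)^{−2}, l = −(2/√c)·max(1, 1/(p−1))·log ε, χ_l(s) = χ(s/l), Φ(r) = χ_l(r−ρ)·Q_c(r−ρ), and Ψ(r) = −d/dr[ χ_l(r−ρ)·Q_c(r−ρ) ] − 2ε(ερ)^{−3}·χ_l(r−ρ)·(∂_cQ_c)(r−ρ), where ∂_cQ_c is the partial derivative in c of the explicit formula for Q_c. Then there exist ε*>0 and c₁>0 such that for every ε ∈ (0, ε*), every ρ ∈ (α₀/(2ε), 2α₀/ε), and every w ∈ C¹((0,∞), ℝ) with ∫₀^∞ (w'(r)² + w(r)² + r^{−2}w(r)²) r dr < ∞, ∫₀^∞ w(r)Ψ(r) r dr = 0 and ∫₀^∞ w(r)Φ(r)^{(p+1)/2} r dr = 0, one has ∫₀^∞ [ w'(r)² + (ω + (εr)^{−2})·w(r)² − p·Φ(r)^{p−1}·w(r)² ] r dr ≥ c₁ ∫₀^∞ w(r)² r dr. -/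

import Mathlib

open MeasureTheory Real Filter

/-- The 1D soliton profile `Q_c`. -/
noncomputable def Qc (p c : ℝ) : ℝ → ℝ := fun x =>
  ((p + 1) * c / 2) ^ (1 / (p - 1)) *
    (1 / Real.cosh ((p - 1) * Real.sqrt c * x / 2)) ^ (2 / (p - 1))

/-- The partial derivative in `c` of the explicit formula for `Q_c`. -/
noncomputable def dQc (p c : ℝ) : ℝ → ℝ := fun x => deriv (fun c' => Qc p c' x) c

/-- The hyperbolic secant. -/
noncomputable def sech (x : ℝ) : ℝ := 1 / Real.cosh x

lemma sech_pos (x : ℝ) : 0 < sech x := by unfold sech; positivity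

lemma sech_le_one (x : ℝ) : sech x ≤ 1 := by
  unfold sech
  rw [div_le_one (Real.cosh_pos x)]
  exact Real.one_le_cosh x

lemma continuous_sech : Continuous sech := by
  unfold sech
  exact continuous_const.div Real.continuous_cosh fun x => (Real.cosh_pos x).ne'

lemma continuous_tanh' : Continuous Real.tanh := by
  have h : Real.tanh = fun x => Real.sinh x / Real.cosh x := by
    funext x; exact Real.tanh_eq_sinh_div_cosh x
  rw [h]
  exact Real.continuous_sinh.div Real.continuous_cosh fun x => (Real.cosh_pos x).ne'

lemma tanh_sq_eq (x : ℝ) : Real.tanh x ^ 2 = 1 - sech x ^ 2 := by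
  unfold sech
  rw [Real.tanh_eq_sinh_div_cosh]
  have := Real.cosh_sq x
  field_simp
  linarith

lemma hasDerivAt_tanh_sech (x : ℝ) : HasDerivAt Real.tanh (sech x ^ 2) x := by
  have h : Real.tanh = fun x => Real.sinh x / Real.cosh x := by
    funext x; exact Real.tanh_eq_sinh_div_cosh x
  rw [h]
  refine ((Real.hasDerivAt_sinh x).div (Real.hasDerivAt_cosh x)
    (Real.cosh_pos x).ne').congr_deriv ?_
  unfold sech
  have := Real.cosh_sq x
  field_simp
  linarith

lemma hasDerivAt_sech (x : ℝ) : HasDerivAt sech (-(Real.tanh x * sech x)) x := by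
  unfold sech
  refine ((hasDerivAt_const x (1 : ℝ)).div (Real.hasDerivAt_cosh x)
    (Real.cosh_pos x).ne').congr_deriv ?_
  rw [Real.tanh_eq_sinh_div_cosh]
  field_simp
  ring

lemma hasDerivAt_sech_rpow (k x : ℝ) :
    HasDerivAt (fun x => sech x ^ k) (-(k * Real.tanh x * sech x ^ k)) x := by
  refine ((hasDerivAt_sech x).rpow_const (p := k) (Or.inl (sech_pos x).ne')).congr_deriv ?_
  rw [Real.rpow_sub_one (sech_pos x).ne']
  have := (sech_pos x).ne'
  field_simp

lemma continuous_sech_rpow (k : ℝ) : Continuous (fun x => sech x ^ k) :=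
  continuous_iff_continuousAt.2 fun x => (hasDerivAt_sech_rpow k x).continuousAt

/-- A pointwise form of the Cauchy–Schwarz inequality. -/
lemma sq_integral_le {α : Type*} [MeasurableSpace α] {μ : Measure α} {F G H : α → ℝ}
    (hG : Integrable G μ) (hH : Integrable H μ) (hG0 : ∀ᵐ x ∂μ, 0 ≤ G x) (hH0 : ∀ᵐ x ∂μ, 0 ≤ H x)
    (h : ∀ᵐ x ∂μ, F x ^ 2 ≤ G x * H x) :
    (∫ x, F x ∂μ) ^ 2 ≤ (∫ x, G x ∂μ) * ∫ x, H x ∂μ := by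
  by_cases hF : Integrable F μ
  · have key : ∀ t : ℝ, 0 ≤ (∫ x, G x ∂μ) * (t * t) + (2 * ∫ x, F x ∂μ) * t + ∫ x, H x ∂μ := by
      intro t
      have e : (∫ x, G x ∂μ) * (t * t) + (2 * ∫ x, F x ∂μ) * t + ∫ x, H x ∂μ
          = ∫ x, ((t * t) * G x + (2 * t) * F x + H x) ∂μ := by
        rw [integral_add (f := fun x => (t * t) * G x + (2 * t) * F x)
            ((hG.const_mul _).add (hF.const_mul _)) hH,
          integral_add (hG.const_mul _) (hF.const_mul _), integral_const_mul, integral_const_mul]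
        ring
      rw [e]
      apply integral_nonneg_of_ae
      filter_upwards [hG0, hH0, h] with x h1 h2 h3
      simp only [Pi.zero_apply]
      rcases eq_or_lt_of_le h1 with h4 | h4
      · rw [← h4] at h3 ⊢
        have : F x = 0 := by nlinarith
        rw [this]; linarith
      · have : 0 ≤ G x * ((t * t) * G x + (2 * t) * F x + H x) := by
          nlinarith [sq_nonneg (t * G x + F x)]
        exact nonneg_of_mul_nonneg_right this h4
    have := discrim_le_zero key
    unfold discrim at this
    nlinarith
  · rw [integral_undef hF]
    have h1 := integral_nonneg_of_ae hG0
    have h2 := integral_nonneg_of_ae hH0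
    simpa using mul_nonneg h1 h2

lemma integrable_of_vanishing {f F : ℝ → ℝ} (hf : HasCompactSupport f) (hF : Continuous F)
    (h : ∀ x, f x = 0 → deriv f x = 0 → F x = 0) : Integrable F := by
  apply hF.integrable_of_hasCompactSupport
  apply HasCompactSupport.intro hf
  intro x hx
  apply h x (image_eq_zero_of_notMem_tsupport hx)
  by_contra h'
  exact hx (support_deriv_subset h')

lemma integral_sq_deriv_add_tanh (k : ℝ) {f : ℝ → ℝ} (hf : ContDiff ℝ 1 f)
    (hfc : HasCompactSupport f) :
    ∫ x, (deriv f x + k * Real.tanh x * f x) ^ 2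
      = ∫ x, (deriv f x ^ 2 + (k ^ 2 - k * (k + 1) * sech x ^ 2) * f x ^ 2) := by
  have hf0 := hf.continuous
  have hf1 := (contDiff_one_iff_deriv.1 hf).2
  have hd := (contDiff_one_iff_deriv.1 hf).1
  have ct := continuous_tanh'
  have cs := continuous_sech
  rw [← sub_eq_zero, ← integral_sub]
  · apply integral_eq_zero_of_hasDerivAt_of_integrable (f := fun x => k * Real.tanh x * f x ^ 2)
    · intro x
      refine (((hasDerivAt_tanh_sech x).const_mul k).mul
        ((hd x).hasDerivAt.pow 2)).congr_deriv ?_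
      have := tanh_sq_eq x
      simp only [Nat.cast_ofNat, Pi.pow_apply, Nat.add_one_sub_one, pow_one]
      linear_combination (-(k ^ 2) * f x ^ 2) * this
    · apply integrable_of_vanishing hfc (by fun_prop)
      intro x h1 h2; simp [h1, h2]
    · apply integrable_of_vanishing hfc (by fun_prop)
      intro x h1 h2; simp [h1]
  · apply integrable_of_vanishing hfc (by fun_prop)
    intro x h1 h2; simp [h1, h2]
  · apply integrable_of_vanishing hfc (by fun_prop)
    intro x h1 h2; simp [h1, h2]

lemma exists_primitive (k : ℝ) {v : ℝ → ℝ} (hv : Continuous v) (hvc : HasCompactSupport v)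
    (h0 : ∫ x, v x * sech x ^ k = 0) :
    ∃ u : ℝ → ℝ, ContDiff ℝ 1 u ∧ HasCompactSupport u ∧
      ∀ x, v x = -deriv u x + k * Real.tanh x * u x := by
  obtain ⟨a, ha⟩ := hvc.isCompact.isBounded.subset_ball 0
  have hz : ∀ x, a ≤ |x| → v x = 0 := by
    intro x hx
    by_contra h
    have := ha (subset_tsupport v h)
    simp at this
    linarith
  have hc : Continuous fun x => v x * sech x ^ k := hv.mul (continuous_sech_rpow k)
  set I : ℝ → ℝ := fun x => ∫ t in (-a)..x, v t * sech t ^ k with hI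
  have hId : ∀ x, HasDerivAt I (v x * sech x ^ k) x := fun x =>
    intervalIntegral.integral_hasDerivAt_right (hc.intervalIntegrable _ _)
      (hc.stronglyMeasurableAtFilter _ _) hc.continuousAt
  have hud : ∀ x, HasDerivAt (fun x => -(sech x ^ (-k) * I x))
      (-(-(-k * Real.tanh x * sech x ^ (-k)) * I x + sech x ^ (-k) * (v x * sech x ^ k))) x :=
    fun x => ((hasDerivAt_sech_rpow (-k) x).mul (hId x)).neg
  have hone : ∀ x, sech x ^ (-k) * sech x ^ k = 1 := by
    intro x
    rw [← Real.rpow_add (sech_pos x)]; simp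
  refine ⟨fun x => -(sech x ^ (-k) * I x), ?_, ?_, ?_⟩
  · rw [contDiff_one_iff_deriv]
    refine ⟨fun x => (hud x).differentiableAt, ?_⟩
    rw [show deriv (fun x => -(sech x ^ (-k) * I x)) = _ from funext fun x => (hud x).deriv]
    have hIc : Continuous I := continuous_iff_continuousAt.2 fun x => (hId x).continuousAt
    have c1 := continuous_sech_rpow (-k)
    have c2 := continuous_sech_rpow k
    have ct := continuous_tanh'
    fun_prop
  · apply HasCompactSupport.intro (isCompact_Icc (a := -|a|) (b := |a|))
    intro x hx
    have hx' : |a| < |x| := by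
      by_contra h
      push Not at h
      exact hx (abs_le.1 h)
    have : I x = 0 := by
      rcases le_or_gt 0 x with hx0 | hx0
      · rw [abs_of_nonneg hx0] at hx'
        rw [hI, ← h0]
        apply intervalIntegral.integral_eq_integral_of_support_subset
        intro t ht
        have : v t ≠ 0 := fun h => ht (by simp [h])
        have h3 : |t| < a := by
          by_contra h; exact this (hz t (by linarith))
        rw [abs_lt] at h3
        exact ⟨h3.1, by linarith [le_abs_self a]⟩
      · rw [abs_of_neg hx0] at hx'
        rw [hI]
        simp only
        rw [intervalIntegral.integral_congr (g := fun _ => (0:ℝ))]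
        · simp
        · intro t ht
          have hxa : x ≤ -a := by linarith [le_abs_self a]
          rw [Set.uIcc_of_ge hxa] at ht
          simp only
          rw [hz t, zero_mul]
          have := neg_le_abs t
          linarith [ht.2]
    simp [this]
  · intro x
    rw [(hud x).deriv]
    have := hone x
    linear_combination (-v x) * this

lemma le_integral_sq_of_primitive {k lam : ℝ} {u v : ℝ → ℝ} (hlam : 0 < lam)
    (hu : ContDiff ℝ 1 u) (huc : HasCompactSupport u) (hv : ContDiff ℝ 1 v)
    (hvc : HasCompactSupport v) (h : ∀ x, v x = -deriv u x + k * Real.tanh x * u x)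
    (hb : lam * ∫ x, u x ^ 2 ≤ ∫ x, (deriv u x + (-k) * Real.tanh x * u x) ^ 2) :
    lam * ∫ x, v x ^ 2 ≤ ∫ x, (deriv v x + k * Real.tanh x * v x) ^ 2 := by
  have hu0 := hu.continuous
  have hu1 := (contDiff_one_iff_deriv.1 hu).2
  have hud := (contDiff_one_iff_deriv.1 hu).1
  have hv0 := hv.continuous
  have hv1 := (contDiff_one_iff_deriv.1 hv).2
  have hvd := (contDiff_one_iff_deriv.1 hv).1
  have ct := continuous_tanh'
  have e1 : ∫ x, (deriv u x + (-k) * Real.tanh x * u x) ^ 2 = ∫ x, v x ^ 2 := by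
    congr 1; funext x; rw [h x]; ring
  rw [e1] at hb
  have i1 : Integrable fun x => v x ^ 2 := by
    apply integrable_of_vanishing hvc (by fun_prop)
    intro x h1 h2; simp [h1]
  have i2 : Integrable fun x => u x ^ 2 := by
    apply integrable_of_vanishing huc (by fun_prop)
    intro x h1 h2; simp [h1]
  have i3 : Integrable fun x => (deriv v x + k * Real.tanh x * v x) ^ 2 := by
    apply integrable_of_vanishing hvc (by fun_prop)
    intro x h1 h2; simp [h1, h2]
  have i4 : Integrable fun x => (deriv v x + k * Real.tanh x * v x) * u x := by
    apply integrable_of_vanishing huc (by fun_prop)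
    intro x h1 h2; simp [h1]
  have e2 : ∫ x, v x ^ 2 = ∫ x, (deriv v x + k * Real.tanh x * v x) * u x := by
    rw [← sub_eq_zero, ← integral_sub i1 i4]
    apply integral_eq_zero_of_hasDerivAt_of_integrable (f := fun x => -(u x * v x))
    · intro x
      refine ((hud x).hasDerivAt.mul (hvd x).hasDerivAt).neg.congr_deriv ?_
      have := h x
      linear_combination (-v x) * this
    · exact i1.sub i4
    · apply integrable_of_vanishing huc (by fun_prop)
      intro x h1 h2; simp [h1]
  have cs := sq_integral_le (F := fun x => (deriv v x + k * Real.tanh x * v x) * u x) i3 i2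
    (ae_of_all _ fun x => sq_nonneg _) (ae_of_all _ fun x => sq_nonneg _)
    (ae_of_all _ fun x => (mul_pow _ _ 2).le)
  rw [← e2] at cs
  have hY : 0 ≤ ∫ x, (deriv v x + k * Real.tanh x * v x) ^ 2 :=
    integral_nonneg fun x => sq_nonneg _
  have hX : 0 ≤ ∫ x, v x ^ 2 := integral_nonneg fun x => sq_nonneg _
  rcases eq_or_lt_of_le hX with h0 | h0
  · rw [← h0]; simpa using hY
  · have : (∫ x, v x ^ 2) * (lam * ∫ x, v x ^ 2)
        ≤ (∫ x, v x ^ 2) * ∫ x, (deriv v x + k * Real.tanh x * v x) ^ 2 := by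
      nlinarith
    exact le_of_mul_le_mul_left this h0

lemma exists_mul_integral_sq_le {m : ℝ} (hm : 0 < m) :
    ∃ μ > 0, ∀ y : ℝ → ℝ, ContDiff ℝ 1 y → HasCompactSupport y →
      μ * ∫ x, y x ^ 2 ≤ ∫ x, (deriv y x + (-m) * Real.tanh x * y x) ^ 2 := by
  rcases le_or_gt m 1 with hm1 | hm1
  · refine ⟨m ^ 2, by positivity, fun y hy hyc => ?_⟩
    have hy0 := hy.continuous
    have hy1 := (contDiff_one_iff_deriv.1 hy).2
    have cs := continuous_sech
    rw [integral_sq_deriv_add_tanh _ hy hyc, ← integral_const_mul]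
    apply integral_mono
    · apply integrable_of_vanishing hyc (by fun_prop)
      intro x h1 h2; simp [h1]
    · apply integrable_of_vanishing hyc (by fun_prop)
      intro x h1 h2; simp [h1, h2]
    · intro x
      have : 0 ≤ m * (1 - m) * sech x ^ 2 * y x ^ 2 :=
        mul_nonneg (mul_nonneg (mul_nonneg hm.le (by linarith)) (sq_nonneg _)) (sq_nonneg _)
      simp only
      nlinarith [sq_nonneg (deriv y x)]
  · refine ⟨2 * m - 1, by linarith, fun y hy hyc => ?_⟩
    have hy0 := hy.continuous
    have hy1 := (contDiff_one_iff_deriv.1 hy).2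
    have cs := continuous_sech
    have h1 := integral_sq_deriv_add_tanh (m - 1) hy hyc
    have h2 : 0 ≤ ∫ x, (deriv y x + (m - 1) * Real.tanh x * y x) ^ 2 :=
      integral_nonneg fun x => sq_nonneg _
    have h3 : ∫ x, (deriv y x + (-m) * Real.tanh x * y x) ^ 2
        = (∫ x, (deriv y x ^ 2 + ((m - 1) ^ 2 - (m - 1) * (m - 1 + 1) * sech x ^ 2) * y x ^ 2))
          + (2 * m - 1) * ∫ x, y x ^ 2 := by
      rw [integral_sq_deriv_add_tanh _ hy hyc, ← integral_const_mul, ← integral_add]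
      · congr 1; funext x; ring
      · apply integrable_of_vanishing hyc (by fun_prop)
        intro x h1 h2; simp [h1, h2]
      · apply integrable_of_vanishing hyc (by fun_prop)
        intro x h1 h2; simp [h1]
    linarith

/-- Spectral gap of the Pöschl–Teller operator on the orthogonal complement of its two lowest
eigenfunctions. -/
lemma poschlTeller_gap {m : ℝ} (hm : 0 < m) :
    ∃ μ > 0, ∀ v : ℝ → ℝ, ContDiff ℝ 1 v → HasCompactSupport v →
      ∫ x, v x * sech x ^ (m + 1) = 0 → ∫ x, v x * (sech x ^ m * Real.tanh x) = 0 →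
      μ * ∫ x, v x ^ 2
        ≤ ∫ x, (deriv v x ^ 2 + (m ^ 2 - (m + 1) * (m + 2) * sech x ^ 2) * v x ^ 2) := by
  obtain ⟨μ, hμ, hgap⟩ := exists_mul_integral_sq_le hm
  refine ⟨μ, hμ, fun v hv hvc h0 h1 => ?_⟩
  obtain ⟨u, hu, huc, huv⟩ := exists_primitive (m + 1) hv.continuous hvc h0
  have hu0 := hu.continuous
  have hu1 := (contDiff_one_iff_deriv.1 hu).2
  have hud := (contDiff_one_iff_deriv.1 hu).1
  have hv0 := hv.continuous
  have hv1 := (contDiff_one_iff_deriv.1 hv).2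
  have ct := continuous_tanh'
  have cs := continuous_sech
  have csm := continuous_sech_rpow m
  have hum : ∫ x, u x * sech x ^ m = 0 := by
    rw [← h1, ← sub_eq_zero, ← integral_sub]
    · apply integral_eq_zero_of_hasDerivAt_of_integrable
        (f := fun x => u x * (sech x ^ m * Real.tanh x))
      · intro x
        refine ((hud x).hasDerivAt.mul
          ((hasDerivAt_sech_rpow m x).mul (hasDerivAt_tanh_sech x))).congr_deriv ?_
        have e := huv x
        have t := tanh_sq_eq x
        simp only [Pi.mul_apply]
        linear_combination (sech x ^ m * Real.tanh x) * e + (u x * sech x ^ m) * t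
      · apply integrable_of_vanishing huc
        · fun_prop
        · intro x h1 h2
          simp [huv x, h1, h2]
      · apply integrable_of_vanishing huc (by fun_prop)
        intro x h1 h2; simp [h1]
    · apply integrable_of_vanishing huc (by fun_prop)
      intro x h1 h2; simp [h1]
    · apply integrable_of_vanishing huc (by fun_prop)
      intro x h1 h2; simp [huv x, h1, h2]
  obtain ⟨y, hy, hyc, hyu⟩ := exists_primitive m hu0 huc hum
  have g1 := le_integral_sq_of_primitive hμ hy hyc hu huc hyu (hgap y hy hyc)
  have g2 : (μ + (2 * m + 1)) * ∫ x, u x ^ 2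
      ≤ ∫ x, (deriv u x + (-(m + 1)) * Real.tanh x * u x) ^ 2 := by
    have e : ∫ x, (deriv u x + (-(m + 1)) * Real.tanh x * u x) ^ 2
        = (∫ x, (deriv u x ^ 2 + (m ^ 2 - m * (m + 1) * sech x ^ 2) * u x ^ 2))
          + (2 * m + 1) * ∫ x, u x ^ 2 := by
      rw [integral_sq_deriv_add_tanh _ hu huc, ← integral_const_mul, ← integral_add]
      · congr 1; funext x; ring
      · apply integrable_of_vanishing huc (by fun_prop)
        intro x h1 h2; simp [h1, h2]
      · apply integrable_of_vanishing huc (by fun_prop)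
        intro x h1 h2; simp [h1]
    rw [integral_sq_deriv_add_tanh _ hu huc] at g1
    rw [e]; linarith
  have g3 := le_integral_sq_of_primitive (by linarith) hu huc hv hvc huv g2
  have e : ∫ x, (deriv v x + (m + 1) * Real.tanh x * v x) ^ 2
      = (∫ x, (deriv v x ^ 2 + (m ^ 2 - (m + 1) * (m + 2) * sech x ^ 2) * v x ^ 2))
        + (2 * m + 1) * ∫ x, v x ^ 2 := by
    rw [integral_sq_deriv_add_tanh _ hv hvc, ← integral_const_mul, ← integral_add]
    · congr 1; funext x; ring
    · apply integrable_of_vanishing hvc (by fun_prop)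
      intro x h1 h2; simp [h1, h2]
    · apply integrable_of_vanishing hvc (by fun_prop)
      intro x h1 h2; simp [h1]
  rw [e] at g3; linarith

lemma integral_three_terms {α : Type*} [MeasurableSpace α] {μ : Measure α} {f g h : α → ℝ}
    (hf : Integrable f μ) (hg : Integrable g μ) (hh : Integrable h μ) (a b c : ℝ) :
    a * (∫ x, f x ∂μ) - b * (∫ x, g x ∂μ) - c * (∫ x, h x ∂μ)
      = ∫ x, (a * f x - b * g x - c * h x) ∂μ := by
  rw [integral_sub (f := fun x => a * f x - b * g x) ((hf.const_mul a).sub (hg.const_mul b))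
    (hh.const_mul c), integral_sub (hf.const_mul a) (hg.const_mul b), integral_const_mul,
    integral_const_mul, integral_const_mul]

lemma perturbed_form_ge {δ B P : ℝ} (hδ : 0 < δ) (hB : 0 < B) (hP : |P| ≤ B) (q q' z z' : ℝ) :
    (1 - δ) * (q ^ 2 + P * z ^ 2) - δ * (B + 1) * z ^ 2
        - (1 / δ + B ^ 2 / δ + B) * (z' ^ 2 + q' ^ 2)
      ≤ (q + q') ^ 2 + P * (z + z') ^ 2 := by
  obtain ⟨hP2, hP1⟩ := abs_le.1 hP
  have e1 : (q + q') ^ 2 ≥ (1 - δ) * q ^ 2 - 1 / δ * q' ^ 2 := by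
    have : (q + q') ^ 2 - ((1 - δ) * q ^ 2 - 1 / δ * q' ^ 2) = (δ * q + q') ^ 2 / δ + q' ^ 2 := by
      field_simp; ring
    have : 0 ≤ (δ * q + q') ^ 2 / δ + q' ^ 2 := by positivity
    linarith
  have hPP : P ^ 2 ≤ B ^ 2 := by nlinarith
  have e2 : 2 * P * z * z' ≥ -δ * z ^ 2 - B ^ 2 / δ * z' ^ 2 := by
    have h1 : 2 * P * z * z' + δ * z ^ 2 + P ^ 2 / δ * z' ^ 2 = (δ * z + P * z') ^ 2 / δ := by
      field_simp; ring
    have h2 : 0 ≤ (δ * z + P * z') ^ 2 / δ := by positivity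
    have h3 : P ^ 2 / δ * z' ^ 2 ≤ B ^ 2 / δ * z' ^ 2 := by gcongr
    linarith
  have e3 : P * z' ^ 2 ≥ -B * z' ^ 2 := by gcongr
  have e4 : δ * P * z ^ 2 ≥ -(δ * B) * z ^ 2 := by nlinarith [mul_nonneg hδ.le (sq_nonneg z)]
  have e5 : 0 ≤ (B ^ 2 / δ + B) * q' ^ 2 := by positivity
  have e6 : 0 ≤ 1 / δ * z' ^ 2 := by positivity
  linarith

/-- A lower bound for the Pöschl–Teller form at `v` from its gap at a compactly supported
perturbation `v - ξ`. -/
lemma form_ge_of_gap_sub {m μ : ℝ} (hm : 0 < m) (hμ : 0 < μ) :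
    ∃ M > 0, ∀ v ξ : ℝ → ℝ, ContDiff ℝ 1 v → HasCompactSupport v → ContDiff ℝ 1 ξ →
      HasCompactSupport ξ →
      (μ * ∫ x, (v x - ξ x) ^ 2 ≤ ∫ x, (deriv (fun x => v x - ξ x) x ^ 2
        + (m ^ 2 - (m + 1) * (m + 2) * sech x ^ 2) * (v x - ξ x) ^ 2)) →
      μ / 4 * (∫ x, v x ^ 2) - M * ∫ x, (ξ x ^ 2 + deriv ξ x ^ 2)
        ≤ ∫ x, (deriv v x ^ 2 + (m ^ 2 - (m + 1) * (m + 2) * sech x ^ 2) * v x ^ 2) := by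
  set B := m ^ 2 + (m + 1) * (m + 2) with hB
  have hBpos : 0 < B := by positivity
  set δ := μ / (2 * (μ + B + 1)) with hδ
  have hδpos : 0 < δ := by positivity
  have hδ1 : δ ≤ 1 := by
    rw [hδ, div_le_one (by positivity)]; linarith
  have hδμ : (1 - δ) * μ - δ * (B + 1) = μ / 2 := by
    rw [hδ]; field_simp; ring
  set D := 1 / δ + B ^ 2 / δ + B with hD
  have hDpos : 0 < D := by positivity
  refine ⟨μ / 2 + D, by positivity, fun v ξ hv hvc dξ sξ gap => ?_⟩
  have cs := continuous_sech
  have hv0 := hv.continuous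
  have hv1 := (contDiff_one_iff_deriv.1 hv).2
  set y : ℝ → ℝ := fun x => v x - ξ x with hy
  have dy : ContDiff ℝ 1 y := hv.sub dξ
  have sy : HasCompactSupport y := hvc.sub sξ
  have cy := dy.continuous
  have cdy := (contDiff_one_iff_deriv.1 dy).2
  have cξ := dξ.continuous
  have cdξ := (contDiff_one_iff_deriv.1 dξ).2
  have dvx : ∀ x, deriv v x = deriv y x + deriv ξ x := by
    intro x
    rw [hy, deriv_fun_sub (hv.differentiable_one x) (dξ.differentiable_one x)]
    ring
  set X := ∫ x, (ξ x ^ 2 + deriv ξ x ^ 2) with hX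
  have jy : Integrable fun x => y x ^ 2 := by
    apply integrable_of_vanishing sy (by fun_prop)
    intro x h1 h2; simp [h1]
  have jN : Integrable fun x =>
      deriv y x ^ 2 + (m ^ 2 - (m + 1) * (m + 2) * sech x ^ 2) * y x ^ 2 := by
    apply integrable_of_vanishing sy (by fun_prop)
    intro x h1 h2; simp [h1, h2]
  have jNv : Integrable fun x =>
      deriv v x ^ 2 + (m ^ 2 - (m + 1) * (m + 2) * sech x ^ 2) * v x ^ 2 := by
    apply integrable_of_vanishing hvc (by fun_prop)
    intro x h1 h2; simp [h1, h2]
  have jv : Integrable fun x => v x ^ 2 := by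
    apply integrable_of_vanishing hvc (by fun_prop)
    intro x h1 h2; simp [h1]
  have jX : Integrable fun x => ξ x ^ 2 + deriv ξ x ^ 2 := by
    apply integrable_of_vanishing sξ (by fun_prop)
    intro x h1 h2; simp [h1, h2]
  have s1 : (1 - δ) * (∫ x, (deriv y x ^ 2 + (m ^ 2 - (m + 1) * (m + 2) * sech x ^ 2) * y x ^ 2))
      - δ * (B + 1) * (∫ x, y x ^ 2) - D * X
      ≤ ∫ x, (deriv v x ^ 2 + (m ^ 2 - (m + 1) * (m + 2) * sech x ^ 2) * v x ^ 2) := by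
    rw [hX, integral_three_terms jN jy jX]
    apply integral_mono (((jN.const_mul _).sub (jy.const_mul _)).sub (jX.const_mul _)) jNv
    intro x
    have hs0 : 0 ≤ sech x ^ 2 := by positivity
    have hs1 : sech x ^ 2 ≤ 1 := pow_le_one₀ (sech_pos x).le (sech_le_one x)
    have hmm : 0 < (m + 1) * (m + 2) := by positivity
    have hP : |m ^ 2 - (m + 1) * (m + 2) * sech x ^ 2| ≤ B := by
      rw [abs_le]; constructor <;> nlinarith [sq_nonneg m]
    have := perturbed_form_ge hδpos hBpos hP (deriv y x) (deriv ξ x) (y x) (ξ x)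
    have hvx : v x = y x + ξ x := by simp [hy]
    simp only
    rw [dvx x, hvx]
    exact this
  have s2 : (∫ x, v x ^ 2) / 2 - X ≤ ∫ x, y x ^ 2 := by
    rw [← integral_div, hX, ← integral_sub (jv.div_const 2) jX]
    apply integral_mono ((jv.div_const 2).sub jX) jy
    intro x
    simp only [hy, Pi.sub_apply]
    nlinarith [sq_nonneg (v x - 2 * ξ x), sq_nonneg (deriv ξ x)]
  have s4 : (1 - δ) * (μ * ∫ x, y x ^ 2) ≤ (1 - δ) *
      ∫ x, (deriv y x ^ 2 + (m ^ 2 - (m + 1) * (m + 2) * sech x ^ 2) * y x ^ 2) :=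
    mul_le_mul_of_nonneg_left gap (by linarith)
  have s5 : μ / 2 * (∫ x, y x ^ 2) - D * X
      ≤ ∫ x, (deriv v x ^ 2 + (m ^ 2 - (m + 1) * (m + 2) * sech x ^ 2) * v x ^ 2) := by
    rw [← hδμ]; linarith
  have s10 := mul_le_mul_of_nonneg_left s2 (by positivity : 0 ≤ μ / 2)
  linarith

/-- Coercivity of the Pöschl–Teller form up to the two lowest modes. -/
lemma poschlTeller_coercive {m : ℝ} (hm : 0 < m) :
    ∃ μ > 0, ∃ K > 0, ∀ v : ℝ → ℝ, ContDiff ℝ 1 v → HasCompactSupport v →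
      μ * (∫ x, v x ^ 2) - K * ((∫ x, v x * sech x ^ (m + 1)) ^ 2
          + (∫ x, v x * (sech x ^ m * Real.tanh x)) ^ 2)
        ≤ ∫ x, (deriv v x ^ 2 + (m ^ 2 - (m + 1) * (m + 2) * sech x ^ 2) * v x ^ 2) := by
  obtain ⟨μ, hμ, hgap⟩ := poschlTeller_gap hm
  let θ : ContDiffBump (0 : ℝ) := ⟨1, 2, one_pos, one_lt_two⟩
  have ct := continuous_tanh'
  have cs := continuous_sech
  have csk := continuous_sech_rpow
  have hθc : HasCompactSupport θ := θ.hasCompactSupport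
  have hθ : ContDiff ℝ 1 θ := θ.contDiff
  have cθ := hθ.continuous
  have hθ1 : ∀ x, |x| ≤ 1 → θ x = 1 := fun x hx =>
    θ.one_of_mem_closedBall (by simpa [θ] using hx)
  have dsech : ∀ k : ℝ, ContDiff ℝ 1 fun x => sech x ^ k := by
    intro k
    rw [contDiff_one_iff_deriv]
    refine ⟨fun x => (hasDerivAt_sech_rpow k x).differentiableAt, ?_⟩
    rw [show deriv (fun x => sech x ^ k) = _ from funext fun x => (hasDerivAt_sech_rpow k x).deriv]
    fun_prop
  have dtanh : ContDiff ℝ 1 Real.tanh := by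
    rw [contDiff_one_iff_deriv]
    refine ⟨fun x => (hasDerivAt_tanh_sech x).differentiableAt, ?_⟩
    rw [show deriv Real.tanh = _ from funext fun x => (hasDerivAt_tanh_sech x).deriv]
    fun_prop
  set φ₀ : ℝ → ℝ := fun x => sech x ^ (m + 1) with hφ₀
  set φ₁ : ℝ → ℝ := fun x => sech x ^ m * Real.tanh x with hφ₁
  have dφ₀ : ContDiff ℝ 1 φ₀ := dsech _
  have dφ₁ : ContDiff ℝ 1 φ₁ := (dsech _).mul dtanh
  have cφ₀ := dφ₀.continuous
  have cφ₁ := dφ₁.continuous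
  have even₀ : ∀ x, φ₀ (-x) = φ₀ x := by intro x; simp [hφ₀, sech]
  have odd₁ : ∀ x, φ₁ (-x) = -φ₁ x := by intro x; simp [hφ₁, sech, Real.tanh_neg]
  set ξ₀ : ℝ → ℝ := fun x => θ x * φ₀ x with hξ₀
  set ξ₁ : ℝ → ℝ := fun x => θ x * φ₁ x with hξ₁
  have dξ₀ : ContDiff ℝ 1 ξ₀ := hθ.mul dφ₀
  have dξ₁ : ContDiff ℝ 1 ξ₁ := hθ.mul dφ₁
  have sξ₀ : HasCompactSupport ξ₀ := hθc.mul_right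
  have sξ₁ : HasCompactSupport ξ₁ := hθc.mul_right
  have cross : ∫ x, θ x * (φ₀ x * φ₁ x) = 0 := by
    have h := integral_neg_eq_self (fun x => θ x * (φ₀ x * φ₁ x)) (volume : Measure ℝ)
    simp only [θ.neg, even₀, odd₁, mul_neg, integral_neg] at h
    linarith
  have pos : ∀ φ : ℝ → ℝ, Continuous φ → φ 1 ≠ 0 → 0 < ∫ x, θ x * (φ x * φ x) := by
    intro φ cφ hφ
    apply Continuous.integral_pos_of_hasCompactSupport_nonneg_nonzero (x := 1) (by fun_prop)
    · exact hθc.mul_right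
    · intro x; exact mul_nonneg θ.nonneg (mul_self_nonneg _)
    · rw [hθ1 1 (by simp), one_mul]; exact mul_self_ne_zero.2 hφ
  have g₀ := pos φ₀ cφ₀ (Real.rpow_pos_of_pos (sech_pos _) _).ne'
  have g₁ := pos φ₁ cφ₁ (mul_ne_zero (Real.rpow_pos_of_pos (sech_pos _) _).ne'
    (by rw [Real.tanh_eq_sinh_div_cosh]; exact (div_pos (Real.sinh_pos_iff.2 one_pos)
      (Real.cosh_pos _)).ne'))
  set G₀ := ∫ x, θ x * (φ₀ x * φ₀ x) with hG₀
  set G₁ := ∫ x, θ x * (φ₁ x * φ₁ x) with hG₁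
  set X₀ := ∫ x, (ξ₀ x ^ 2 + deriv ξ₀ x ^ 2) with hX₀
  set X₁ := ∫ x, (ξ₁ x ^ 2 + deriv ξ₁ x ^ 2) with hX₁
  have X₀n : 0 ≤ X₀ := integral_nonneg fun x => by positivity
  have X₁n : 0 ≤ X₁ := integral_nonneg fun x => by positivity
  obtain ⟨M, hMpos, hM⟩ := form_ge_of_gap_sub hm hμ
  refine ⟨μ / 4, by positivity, M * (2 * (X₀ / G₀ ^ 2 + X₁ / G₁ ^ 2)) + 1, by positivity, ?_⟩
  intro v hv hvc
  have hv0 := hv.continuous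
  have hv1 := (contDiff_one_iff_deriv.1 hv).2
  set A₀ := ∫ x, v x * sech x ^ (m + 1) with hA₀
  set A₁ := ∫ x, v x * (sech x ^ m * Real.tanh x) with hA₁
  set a := A₀ / G₀ with ha
  set b := A₁ / G₁ with hb
  set ξ : ℝ → ℝ := fun x => a * ξ₀ x + b * ξ₁ x with hξ
  have dξ : ContDiff ℝ 1 ξ := (contDiff_const.mul dξ₀).add (contDiff_const.mul dξ₁)
  have sξ : HasCompactSupport ξ := (sξ₀.mul_left (f := fun _ => a)).add (sξ₁.mul_left (f := fun _ => b))
  set y : ℝ → ℝ := fun x => v x - ξ x with hy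
  have iφ : ∀ f φ : ℝ → ℝ, HasCompactSupport f → Continuous f → Continuous φ →
      Integrable fun x => f x * φ x := fun f φ hf cf cφ =>
    (cf.mul cφ).integrable_of_hasCompactSupport hf.mul_right
  have o₀ : ∫ x, y x * sech x ^ (m + 1) = 0 := by
    have e : (fun x => y x * sech x ^ (m + 1)) = fun x => v x * φ₀ x
        - (a * (θ x * (φ₀ x * φ₀ x)) + b * (θ x * (φ₀ x * φ₁ x))) := by
      funext x; simp only [hy, hξ, hξ₀, hξ₁, hφ₀]; ring
    rw [e, integral_sub (iφ v φ₀ hvc hv0 cφ₀), integral_add, integral_const_mul,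
      integral_const_mul, cross]
    · change A₀ - (A₀ / G₀ * G₀ + b * 0) = 0
      rw [div_mul_cancel₀ _ g₀.ne']; ring
    · exact (iφ θ _ hθc cθ (cφ₀.mul cφ₀)).const_mul a
    · exact (iφ θ _ hθc cθ (cφ₀.mul cφ₁)).const_mul b
    · exact ((iφ θ _ hθc cθ (cφ₀.mul cφ₀)).const_mul a).add
        ((iφ θ _ hθc cθ (cφ₀.mul cφ₁)).const_mul b)
  have o₁ : ∫ x, y x * (sech x ^ m * Real.tanh x) = 0 := by
    have e : (fun x => y x * (sech x ^ m * Real.tanh x)) = fun x => v x * φ₁ x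
        - (a * (θ x * (φ₀ x * φ₁ x)) + b * (θ x * (φ₁ x * φ₁ x))) := by
      funext x; simp only [hy, hξ, hξ₀, hξ₁, hφ₁]; ring
    rw [e, integral_sub (iφ v φ₁ hvc hv0 cφ₁), integral_add, integral_const_mul,
      integral_const_mul, cross]
    · change A₁ - (a * 0 + A₁ / G₁ * G₁) = 0
      rw [div_mul_cancel₀ _ g₁.ne']; ring
    · exact (iφ θ _ hθc cθ (cφ₀.mul cφ₁)).const_mul a
    · exact (iφ θ _ hθc cθ (cφ₁.mul cφ₁)).const_mul b
    · exact ((iφ θ _ hθc cθ (cφ₀.mul cφ₁)).const_mul a).add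
        ((iφ θ _ hθc cθ (cφ₁.mul cφ₁)).const_mul b)
  have s5 := hM v ξ hv hvc dξ sξ (hgap y (hv.sub dξ) (hvc.sub sξ) o₀ o₁)
  have cξ := dξ.continuous
  have cdξ := (contDiff_one_iff_deriv.1 dξ).2
  have cdξ₀ := (contDiff_one_iff_deriv.1 dξ₀).2
  have cdξ₁ := (contDiff_one_iff_deriv.1 dξ₁).2
  have cξ₀ := dξ₀.continuous
  have cξ₁ := dξ₁.continuous
  have dξx : ∀ x, deriv ξ x = a * deriv ξ₀ x + b * deriv ξ₁ x := by
    intro x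
    rw [hξ, deriv_fun_add ((dξ₀.differentiable_one x).const_mul a)
      ((dξ₁.differentiable_one x).const_mul b), deriv_const_mul_field, deriv_const_mul_field]
  set X := ∫ x, (ξ x ^ 2 + deriv ξ x ^ 2) with hX
  have jX : Integrable fun x => ξ x ^ 2 + deriv ξ x ^ 2 := by
    apply integrable_of_vanishing sξ (by fun_prop)
    intro x h1 h2; simp [h1, h2]
  have jX₀ : Integrable fun x => ξ₀ x ^ 2 + deriv ξ₀ x ^ 2 := by
    apply integrable_of_vanishing sξ₀ (by fun_prop)
    intro x h1 h2; simp [h1, h2]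
  have jX₁ : Integrable fun x => ξ₁ x ^ 2 + deriv ξ₁ x ^ 2 := by
    apply integrable_of_vanishing sξ₁ (by fun_prop)
    intro x h1 h2; simp [h1, h2]
  have s3 : X ≤ 2 * (a ^ 2 * X₀ + b ^ 2 * X₁) := by
    rw [hX, hX₀, hX₁, ← integral_const_mul, ← integral_const_mul,
      ← integral_add (jX₀.const_mul _) (jX₁.const_mul _), ← integral_const_mul]
    apply integral_mono jX (((jX₀.const_mul _).add (jX₁.const_mul _)).const_mul _)
    intro x
    simp only [dξx x]
    simp only [hξ, Pi.add_apply]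
    clear_value ξ₀ ξ₁ a b
    nlinarith [sq_nonneg (a * ξ₀ x - b * ξ₁ x), sq_nonneg (a * deriv ξ₀ x - b * deriv ξ₁ x)]
  have s6 : M * X ≤ M * (2 * (a ^ 2 * X₀ + b ^ 2 * X₁)) := mul_le_mul_of_nonneg_left s3 hMpos.le
  have s7 : 2 * (a ^ 2 * X₀ + b ^ 2 * X₁)
      ≤ 2 * (X₀ / G₀ ^ 2 + X₁ / G₁ ^ 2) * (A₀ ^ 2 + A₁ ^ 2) := by
    have h1 : a ^ 2 * X₀ = X₀ / G₀ ^ 2 * A₀ ^ 2 := by rw [ha]; field_simp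
    have h2 : b ^ 2 * X₁ = X₁ / G₁ ^ 2 * A₁ ^ 2 := by rw [hb]; field_simp
    have h3 : 0 ≤ X₀ / G₀ ^ 2 * A₁ ^ 2 := by positivity
    have h4 : 0 ≤ X₁ / G₁ ^ 2 * A₀ ^ 2 := by positivity
    rw [h1, h2]; linarith
  have s8 := mul_le_mul_of_nonneg_left s7 hMpos.le
  have s9 : 0 ≤ A₀ ^ 2 + A₁ ^ 2 := by positivity
  linarith

/-- The rescaled and translated form of `poschlTeller_coercive`. -/
lemma poschlTeller_coercive_scaled {m : ℝ} (hm : 0 < m) :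
    ∃ μ > 0, ∃ K > 0, ∀ β > 0, ∀ ρ : ℝ, ∀ f : ℝ → ℝ, ContDiff ℝ 1 f → HasCompactSupport f →
      μ * β ^ 2 * (∫ r, f r ^ 2)
        - K * β ^ 3 * ((∫ r, f r * sech (β * (r - ρ)) ^ (m + 1)) ^ 2
          + (∫ r, f r * (sech (β * (r - ρ)) ^ m * Real.tanh (β * (r - ρ)))) ^ 2)
        ≤ ∫ r, (deriv f r ^ 2
          + β ^ 2 * (m ^ 2 - (m + 1) * (m + 2) * sech (β * (r - ρ)) ^ 2) * f r ^ 2) := by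
  obtain ⟨μ, hμ, K, hK, H⟩ := poschlTeller_coercive hm
  refine ⟨μ, hμ, K, hK, fun β hβ ρ f hf hfc => ?_⟩
  have scale : ∀ g : ℝ → ℝ, ∫ r, g (β * (r - ρ)) = β⁻¹ * ∫ z, g z := by
    intro g
    rw [integral_sub_right_eq_self (fun r => g (β * r)) ρ, Measure.integral_comp_mul_left,
      abs_of_pos (inv_pos.2 hβ), smul_eq_mul]
  set v : ℝ → ℝ := fun z => f (z / β + ρ) with hv
  have fv : ∀ r, v (β * (r - ρ)) = f r := by
    intro r; simp only [hv]; congr 1; field_simp; ring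
  have dv : ∀ r, β * deriv v (β * (r - ρ)) = deriv f r := by
    intro r
    have e : β * (r - ρ) / β + ρ = r := by field_simp; ring
    have h1 : HasDerivAt f (deriv f r) (β * (r - ρ) / β + ρ) := by
      rw [e]; exact (hf.differentiable_one r).hasDerivAt
    have h2 : HasDerivAt (fun z : ℝ => z / β + ρ) (1 / β) (β * (r - ρ)) :=
      ((hasDerivAt_id _).div_const β).add_const ρ
    have h3 : HasDerivAt v (deriv f r * (1 / β)) (β * (r - ρ)) := h1.comp (β * (r - ρ)) h2
    rw [h3.deriv]
    field_simp
  have cv : ContDiff ℝ 1 v := hf.comp ((contDiff_id.div_const β).add contDiff_const)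
  have sv : HasCompactSupport v := by
    have := hfc.comp_homeomorph ((Homeomorph.mulRight₀ β⁻¹ (inv_ne_zero hβ.ne')).trans
      (Homeomorph.addRight ρ))
    have e : v = f ∘ ((Homeomorph.mulRight₀ β⁻¹ (inv_ne_zero hβ.ne')).trans
        (Homeomorph.addRight ρ)) := by
      funext z; simp [hv, div_eq_mul_inv]
    rw [e]; exact this
  have h := H v cv sv
  have e0 : ∫ r, f r ^ 2 = β⁻¹ * ∫ z, v z ^ 2 := by
    rw [← scale]; simp only [fv]
  have e1 : ∫ r, f r * sech (β * (r - ρ)) ^ (m + 1) = β⁻¹ * ∫ z, v z * sech z ^ (m + 1) := by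
    rw [← scale]; simp only [fv]
  have e2 : ∫ r, f r * (sech (β * (r - ρ)) ^ m * Real.tanh (β * (r - ρ)))
      = β⁻¹ * ∫ z, v z * (sech z ^ m * Real.tanh z) := by
    rw [← scale (fun z => v z * (sech z ^ m * Real.tanh z))]; simp only [fv]
  have e3 : ∫ r, (deriv f r ^ 2
          + β ^ 2 * (m ^ 2 - (m + 1) * (m + 2) * sech (β * (r - ρ)) ^ 2) * f r ^ 2)
      = β * ∫ z, (deriv v z ^ 2 + (m ^ 2 - (m + 1) * (m + 2) * sech z ^ 2) * v z ^ 2) := by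
    have : β * ∫ z, (deriv v z ^ 2 + (m ^ 2 - (m + 1) * (m + 2) * sech z ^ 2) * v z ^ 2)
        = β⁻¹ * ∫ z, β ^ 2 *
          (deriv v z ^ 2 + (m ^ 2 - (m + 1) * (m + 2) * sech z ^ 2) * v z ^ 2) := by
      rw [integral_const_mul]; field_simp
    rw [this, ← scale (fun z => β ^ 2 *
          (deriv v z ^ 2 + (m ^ 2 - (m + 1) * (m + 2) * sech z ^ 2) * v z ^ 2))]
    congr 1; funext r
    rw [fv, ← dv r]; ring
  rw [e0, e1, e2, e3]
  have := mul_le_mul_of_nonneg_left h hβ.le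
  refine le_trans (le_of_eq ?_) this
  field_simp

lemma sech_antitone {x y : ℝ} (h : |x| ≤ |y|) : sech y ≤ sech x := by
  unfold sech
  exact one_div_le_one_div_of_le (Real.cosh_pos x) (Real.cosh_le_cosh.2 h)

lemma sech_sq_mul_sq_le (x : ℝ) : sech x ^ 2 * x ^ 2 ≤ 1 := by
  have h1 : x ^ 2 ≤ Real.cosh x ^ 2 := by
    rw [Real.cosh_sq, ← sq_abs x, ← sq_abs (Real.sinh x), Real.abs_sinh]
    have := Real.self_le_sinh_iff.2 (abs_nonneg x)
    nlinarith [abs_nonneg x]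
  unfold sech
  rw [div_pow, one_pow, one_div, inv_mul_le_iff₀ (by positivity)]
  linarith

lemma sech_le_two_mul_exp (x : ℝ) : sech x ≤ 2 * Real.exp (-|x|) := by
  unfold sech
  rw [div_le_iff₀ (Real.cosh_pos x), ← Real.cosh_abs, Real.cosh_eq]
  have h1 := Real.exp_pos (-|x|)
  have h2 : Real.exp (-|x|) * Real.exp |x| = 1 := by rw [← Real.exp_add]; simp
  nlinarith

lemma integrable_sq_weight {m β : ℝ} (hm : 0 < m) (hβ : 0 < β) :
    Integrable fun x : ℝ => ((1 + |x|) * sech (β * x) ^ m) ^ 2 := by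
  set k := 2 * m * β with hk
  have hkpos : 0 < k := by positivity
  have cs := continuous_sech_rpow m
  have hc : Continuous fun x : ℝ => ((1 + |x|) * sech (β * x) ^ m) ^ 2 :=
    ((continuous_const.add continuous_abs).mul
      (cs.comp (continuous_const.mul continuous_id))).pow 2
  refine (integrable_inv_one_add_sq.const_mul
    ((2 ^ m) ^ 2 * (24 / k ^ 4 * Real.exp k))).mono' hc.aestronglyMeasurable (ae_of_all _ fun x => ?_)
  rw [Real.norm_of_nonneg (sq_nonneg _)]
  have h1 : sech (β * x) ^ m ≤ 2 ^ m * Real.exp (-(m * β * |x|)) := by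
    have := Real.rpow_le_rpow (sech_pos _).le (sech_le_two_mul_exp (β * x)) hm.le
    rw [Real.mul_rpow (by norm_num) (Real.exp_pos _).le, ← Real.exp_mul, abs_mul,
      abs_of_pos hβ] at this
    refine this.trans (le_of_eq ?_)
    congr 2
    ring
  have h2 : (sech (β * x) ^ m) ^ 2 ≤ (2 ^ m) ^ 2 * Real.exp (-(k * |x|)) := by
    have h3 := pow_le_pow_left₀ (Real.rpow_nonneg (sech_pos _).le _) h1 2
    rw [mul_pow, ← Real.exp_nat_mul] at h3
    refine h3.trans (le_of_eq ?_)
    congr 2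
    rw [hk]; push_cast; ring
  have h4 : (1 + |x|) ^ 4 ≤ 24 / k ^ 4 * Real.exp k * Real.exp (k * |x|) := by
    have := Real.pow_div_factorial_le_exp (k * (1 + |x|)) (by positivity) 4
    rw [mul_assoc, ← Real.exp_add, show k + k * |x| = k * (1 + |x|) by ring]
    have e : ((4).factorial : ℝ) = 24 := by norm_num [Nat.factorial]
    rw [e, mul_pow, div_le_iff₀ (by norm_num)] at this
    rw [div_mul_eq_mul_div, le_div_iff₀ (by positivity)]
    linarith
  have h5 : (1 + |x|) ^ 2 * (1 + x ^ 2) ≤ (1 + |x|) ^ 4 := by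
    have : 1 + x ^ 2 ≤ (1 + |x|) ^ 2 := by
      rw [← sq_abs x]; nlinarith [abs_nonneg x]
    calc (1 + |x|) ^ 2 * (1 + x ^ 2) ≤ (1 + |x|) ^ 2 * (1 + |x|) ^ 2 := by gcongr
      _ = _ := by ring
  have h6 : Real.exp (k * |x|) * Real.exp (-(k * |x|)) = 1 := by rw [← Real.exp_add]; simp
  rw [← div_eq_mul_inv, le_div_iff₀ (by positivity)]
  calc ((1 + |x|) * sech (β * x) ^ m) ^ 2 * (1 + x ^ 2)
      = ((1 + |x|) ^ 2 * (1 + x ^ 2)) * (sech (β * x) ^ m) ^ 2 := by ring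
    _ ≤ (24 / k ^ 4 * Real.exp k * Real.exp (k * |x|)) * ((2 ^ m) ^ 2 * Real.exp (-(k * |x|))) := by
        apply mul_le_mul (h5.trans h4) h2 (sq_nonneg _) (by positivity)
    _ = (2 ^ m) ^ 2 * (24 / k ^ 4 * Real.exp k) * (Real.exp (k * |x|) * Real.exp (-(k * |x|))) := by
        ring
    _ = _ := by rw [h6, mul_one]

lemma Qc_eq (p c x : ℝ) :
    Qc p c x = ((p + 1) * c / 2) ^ (1 / (p - 1))
      * sech ((p - 1) * √c / 2 * x) ^ (2 / (p - 1)) := by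
  unfold Qc sech
  rw [show (p - 1) * √c * x / 2 = (p - 1) * √c / 2 * x by ring]

lemma hasDerivAt_Qc (p c x : ℝ) :
    HasDerivAt (Qc p c) (-(((p + 1) * c / 2) ^ (1 / (p - 1)) * (2 / (p - 1))
      * ((p - 1) * √c / 2) * (sech ((p - 1) * √c / 2 * x) ^ (2 / (p - 1))
        * Real.tanh ((p - 1) * √c / 2 * x)))) x := by
  rw [show Qc p c = _ from funext (Qc_eq p c)]
  set β := (p - 1) * √c / 2
  have h1 : HasDerivAt (fun y : ℝ => β * y) β x := by
    simpa using (hasDerivAt_id x).const_mul β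
  refine (((hasDerivAt_sech_rpow (2 / (p - 1)) (β * x)).comp x h1).const_mul _).congr_deriv ?_
  ring

lemma dQc_eq {p c : ℝ} (hp : 1 < p) (hc : 0 < c) (x : ℝ) :
    dQc p c x = Qc p c x * (1 / ((p - 1) * c)
      - x * Real.tanh ((p - 1) * √c / 2 * x) / (2 * √c)) := by
  have hp1 : 0 < p - 1 := by linarith
  have hs : 0 < √c := Real.sqrt_pos.2 hc
  unfold dQc
  rw [show (fun c' => Qc p c' x) = fun c' => ((p + 1) * c' / 2) ^ (1 / (p - 1))
      * sech ((p - 1) * √c' / 2 * x) ^ (2 / (p - 1)) from funext fun c' => Qc_eq p c' x, Qc_eq]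
  have h1 : HasDerivAt (fun c' : ℝ => (p + 1) * c' / 2) ((p + 1) / 2) c := by
    simpa using ((hasDerivAt_id c).const_mul (p + 1)).div_const 2
  have hpos : 0 < (p + 1) * c / 2 := by positivity
  have h2 := h1.rpow_const (p := 1 / (p - 1)) (Or.inl hpos.ne')
  have h3 : HasDerivAt (fun c' : ℝ => (p - 1) * √c' / 2 * x)
      ((p - 1) * (1 / (2 * √c)) / 2 * x) c :=
    ((((Real.hasDerivAt_sqrt hc.ne').const_mul (p - 1)).div_const 2).mul_const x)
  have h4 := (hasDerivAt_sech_rpow (2 / (p - 1)) ((p - 1) * √c / 2 * x)).comp c h3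
  have h5 : HasDerivAt (fun c' : ℝ => ((p + 1) * c' / 2) ^ (1 / (p - 1))
      * sech ((p - 1) * √c' / 2 * x) ^ (2 / (p - 1))) _ c := h2.mul h4
  rw [h5.deriv]
  rw [Real.rpow_sub_one hpos.ne']
  field_simp
  ring

lemma mul_Qc_rpow_sub_one {p c : ℝ} (hp : 1 < p) (hc : 0 < c) (x : ℝ) :
    p * Qc p c x ^ (p - 1) = ((p - 1) * √c / 2) ^ 2
      * ((2 / (p - 1) + 1) * (2 / (p - 1) + 2) * sech ((p - 1) * √c / 2 * x) ^ 2) := by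
  have hp1 : 0 < p - 1 := by linarith
  rw [Qc_eq, Real.mul_rpow (by positivity) (Real.rpow_nonneg (sech_pos _).le _),
    ← Real.rpow_mul (by positivity), ← Real.rpow_mul (sech_pos _).le,
    one_div_mul_cancel hp1.ne', div_mul_cancel₀ _ hp1.ne', Real.rpow_one, Real.rpow_two]
  have : √c ^ 2 = c := Real.sq_sqrt hc.le
  rw [div_pow, mul_pow, this]
  field_simp
  ring

lemma Qc_rpow_half {p c : ℝ} (hp : 1 < p) (hc : 0 < c) (x : ℝ) :
    Qc p c x ^ ((p + 1) / 2) = (((p + 1) * c / 2) ^ (1 / (p - 1))) ^ ((p + 1) / 2)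
      * sech ((p - 1) * √c / 2 * x) ^ (2 / (p - 1) + 1) := by
  have hp1 : 0 < p - 1 := by linarith
  rw [Qc_eq, Real.mul_rpow (by positivity) (Real.rpow_nonneg (sech_pos _).le _),
    ← Real.rpow_mul (sech_pos _).le]
  congr 2
  field_simp
  ring

lemma Qc_pos {p c : ℝ} (hp : 1 < p) (hc : 0 < c) (x : ℝ) : 0 < Qc p c x := by
  rw [Qc_eq]
  exact mul_pos (Real.rpow_pos_of_pos (by positivity) _) (Real.rpow_pos_of_pos (sech_pos _) _)

/-- If a weighted orthogonality condition is close to the unweighted one, the corresponding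
unweighted mode of a localized function is small. -/
lemma sq_mode_le {ρ R C : ℝ} {w V η φ g h : ℝ → ℝ} (hρ : 0 < ρ)
    (hw : IntegrableOn (fun r => w r ^ 2 * r) (Set.Ioi 0)) (hh : Integrable fun x => h x ^ 2)
    (hV : ∀ r, V r = η r * w r) (hV0 : ∀ r ≤ 0, V r = 0)
    (hVφ : Integrable fun r => V r * φ r)
    (hg : IntegrableOn (fun r => w r * g r * r) (Set.Ioi 0))
    (h0 : ∫ r in Set.Ioi (0:ℝ), w r * g r * r = 0)
    (hd0 : ∀ r > 0, r < ρ / 2 → η r * φ r * ρ - g r * r = 0)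
    (hd : ∀ r > 0, |η r * φ r * ρ - g r * r| ≤ C * ρ / R * h (r - ρ)) :
    ρ * (∫ r, V r * φ r) ^ 2
      ≤ 2 * C ^ 2 / R ^ 2 * (∫ x, h x ^ 2) * ∫ r in Set.Ioi (0:ℝ), w r ^ 2 * r := by
  have e : ρ * (∫ r, V r * φ r)
      = ∫ r in Set.Ioi (0:ℝ), w r * (η r * φ r * ρ - g r * r) := by
    rw [← setIntegral_eq_integral_of_forall_compl_eq_zero (s := Set.Ioi (0:ℝ)),
      ← integral_const_mul]
    · calc ∫ r in Set.Ioi (0:ℝ), ρ * (V r * φ r)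
          = (∫ r in Set.Ioi (0:ℝ), ρ * (V r * φ r)) - ∫ r in Set.Ioi (0:ℝ), w r * g r * r := by
            rw [h0, sub_zero]
        _ = ∫ r in Set.Ioi (0:ℝ), (ρ * (V r * φ r) - w r * g r * r) :=
            (integral_sub (hVφ.integrableOn.const_mul ρ) hg).symm
        _ = _ := by congr 1; funext r; rw [hV]; ring
    · intro r hr
      rw [hV0 r (not_lt.1 hr), zero_mul]
  have hh' : Integrable fun r => h (r - ρ) ^ 2 := hh.comp_sub_right ρ
  have key := sq_integral_le (μ := volume.restrict (Set.Ioi (0:ℝ)))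
    (F := fun r => w r * (η r * φ r * ρ - g r * r)) (G := fun r => w r ^ 2 * r)
    (H := fun r => 2 * C ^ 2 * ρ / R ^ 2 * h (r - ρ) ^ 2) hw
    (hh'.integrableOn.const_mul _)
    ((ae_restrict_mem measurableSet_Ioi).mono fun r hr =>
      mul_nonneg (sq_nonneg _) (le_of_lt hr))
    (ae_of_all _ fun r => by positivity)
    ((ae_restrict_mem measurableSet_Ioi).mono fun r hr => by
      have hr0 : 0 < r := hr
      rcases lt_or_ge r (ρ / 2) with h1 | h1
      · rw [hd0 r hr0 h1, mul_zero, zero_pow two_ne_zero]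
        positivity
      · have h2 := pow_le_pow_left₀ (abs_nonneg _) (hd r hr0) 2
        rw [sq_abs] at h2
        have h3 : (C * ρ / R * h (r - ρ)) ^ 2 ≤ r * (2 * C ^ 2 * ρ / R ^ 2 * h (r - ρ) ^ 2) := by
          have : (C * ρ / R * h (r - ρ)) ^ 2 = ρ * (C ^ 2 * ρ / R ^ 2 * h (r - ρ) ^ 2) := by
            ring
          have h4 : 0 ≤ C ^ 2 * ρ / R ^ 2 * h (r - ρ) ^ 2 := by positivity
          rw [this]
          calc ρ * (C ^ 2 * ρ / R ^ 2 * h (r - ρ) ^ 2)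
              ≤ (2 * r) * (C ^ 2 * ρ / R ^ 2 * h (r - ρ) ^ 2) := by gcongr; linarith
            _ = _ := by ring
        rw [mul_pow, mul_assoc (w r ^ 2) r]
        exact mul_le_mul_of_nonneg_left (h2.trans h3) (sq_nonneg _))
  rw [← e, integral_const_mul] at key
  have h5 : ∫ r in Set.Ioi (0:ℝ), h (r - ρ) ^ 2 ≤ ∫ x, h x ^ 2 := by
    rw [← integral_sub_right_eq_self (fun x => h x ^ 2) ρ]
    exact setIntegral_le_integral hh' (ae_of_all _ fun r => sq_nonneg _)
  have hE : 0 ≤ ∫ r in Set.Ioi (0:ℝ), w r ^ 2 * r :=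
    setIntegral_nonneg measurableSet_Ioi fun r hr => mul_nonneg (sq_nonneg _) (le_of_lt hr)
  have h6 : (∫ r in Set.Ioi (0:ℝ), w r ^ 2 * r)
      * (2 * C ^ 2 * ρ / R ^ 2 * ∫ r in Set.Ioi (0:ℝ), h (r - ρ) ^ 2)
      ≤ (∫ r in Set.Ioi (0:ℝ), w r ^ 2 * r) * (2 * C ^ 2 * ρ / R ^ 2 * ∫ x, h x ^ 2) := by
    gcongr
  have h7 := key.trans h6
  have h8 : ρ * (ρ * (∫ r, V r * φ r) ^ 2)
      ≤ ρ * (2 * C ^ 2 / R ^ 2 * (∫ x, h x ^ 2) * ∫ r in Set.Ioi (0:ℝ), w r ^ 2 * r) := by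
    calc ρ * (ρ * (∫ r, V r * φ r) ^ 2) = (ρ * ∫ r, V r * φ r) ^ 2 := by ring
      _ ≤ _ := h7
      _ = _ := by ring
  exact le_of_mul_le_mul_left h8 hρ

lemma kinetic_density_ge {r ρ t M κ d w w' : ℝ} (hr : 0 < r) (ht0 : 0 < t) (ht8 : t ≤ 1 / 8)
    (hρ0 : 0 < ρ) (hκ0 : 0 ≤ κ) (hκ1 : κ ≤ 1) (hd : |d| ≤ M)
    (near : κ ≠ 0 ∨ d ≠ 0 → ρ * (1 - 3 * t) ≤ r) :
    (1 - 4 * t) * (ρ * (κ * w' + d * t * w) ^ 2) - M ^ 2 * t * (w ^ 2 * r) ≤ w' ^ 2 * r := by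
  have hd2 : d ^ 2 ≤ M ^ 2 := by
    rw [← sq_abs d]; exact pow_le_pow_left₀ (abs_nonneg _) hd 2
  by_cases h : κ ≠ 0 ∨ d ≠ 0
  · have h1 := near h
    have k1 : (1 - t) * (κ * w' + d * t * w) ^ 2 ≤ κ ^ 2 * w' ^ 2 + t * d ^ 2 * w ^ 2 := by
      have e : κ ^ 2 * w' ^ 2 + t * d ^ 2 * w ^ 2 - (1 - t) * (κ * w' + d * t * w) ^ 2
          = t * (κ * w' - (1 - t) * d * w) ^ 2 + t ^ 2 * (d * w) ^ 2 := by ring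
      have : 0 ≤ t * (κ * w' - (1 - t) * d * w) ^ 2 + t ^ 2 * (d * w) ^ 2 := by positivity
      linarith
    have k2 : κ ^ 2 * w' ^ 2 ≤ 1 * w' ^ 2 := by
      have : κ ^ 2 ≤ 1 := pow_le_one₀ hκ0 hκ1
      gcongr
    have k3 : t * d ^ 2 * w ^ 2 ≤ t * M ^ 2 * w ^ 2 := by gcongr
    have k4 : (1 - 4 * t) * ρ ≤ (1 - t) * r := by
      have e : (1 - t) * (ρ * (1 - 3 * t)) ≤ (1 - t) * r :=
        mul_le_mul_of_nonneg_left h1 (by linarith)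
      have : 0 ≤ 3 * t ^ 2 * ρ := by positivity
      linarith
    have k5 : (1 - 4 * t) * ρ * (κ * w' + d * t * w) ^ 2
        ≤ (1 - t) * r * (κ * w' + d * t * w) ^ 2 := by gcongr
    have k6 : r * ((1 - t) * (κ * w' + d * t * w) ^ 2) ≤ r * (w' ^ 2 + t * M ^ 2 * w ^ 2) :=
      mul_le_mul_of_nonneg_left (by linarith) hr.le
    linarith
  · push Not at h
    rw [h.1, h.2]
    have h1 : 0 ≤ M ^ 2 * t * (w ^ 2 * r) := by positivity
    have h2 : 0 ≤ w' ^ 2 * r := by positivity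
    simp only [zero_mul, add_zero]
    linarith

lemma potential_density_ge {r ρ t W B c q v : ℝ} (hr : 0 < r) (ht0 : 0 < t)
    (ht8 : t ≤ 1 / 8) (hρ0 : 0 < ρ) (hc : 0 < c)
    (hW : c - W ≤ c * (1 - (ρ / r) ^ 2) ∨ c ≤ W) (hq0 : 0 ≤ q) (hqB : q ≤ B)
    (h1 : ρ * (1 - 3 * t) ≤ r) (h2 : r ≤ ρ * (1 + 3 * t)) :
    (1 - 4 * t) * (ρ * ((c - q) * v ^ 2)) - (15 * c + 7 * B) * t * (ρ * v ^ 2)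
      ≤ (W - q) * r * v ^ 2 := by
  have hB : 0 ≤ B := hq0.trans hqB
  have htρ : 0 ≤ t * ρ := by positivity
  have k0 : c - W ≤ c * (6 * t) := by
    rcases hW with h3 | h3
    · refine h3.trans (mul_le_mul_of_nonneg_left ?_ hc.le)
      have k1 : 1 - 6 * t ≤ (ρ / r) ^ 2 := by
        rw [div_pow, le_div_iff₀ (by positivity)]
        have k2 : (1 - 6 * t) * (1 + 3 * t) ^ 2 ≤ 1 := by
          have e : (1 - 6 * t) * (1 + 3 * t) ^ 2 = 1 - 27 * t ^ 2 - 54 * t ^ 3 := by ring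
          have : 0 ≤ 27 * t ^ 2 + 54 * t ^ 3 := by positivity
          linarith
        calc (1 - 6 * t) * r ^ 2 ≤ (1 - 6 * t) * (ρ * (1 + 3 * t)) ^ 2 :=
              mul_le_mul_of_nonneg_left (pow_le_pow_left₀ hr.le h2 2) (by linarith)
          _ = ρ ^ 2 * ((1 - 6 * t) * (1 + 3 * t) ^ 2) := by ring
          _ ≤ ρ ^ 2 * 1 := mul_le_mul_of_nonneg_left k2 (sq_nonneg _)
          _ = ρ ^ 2 := mul_one _
      linarith
    · have : 0 ≤ c * (6 * t) := by positivity
      linarith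
  have k3 : (c - q - c * (6 * t)) * r ≤ (W - q) * r :=
    mul_le_mul_of_nonneg_right (by linarith) hr.le
  have k4 : |(c - q) * (r - ρ)| ≤ (c + B) * (3 * (t * ρ)) := by
    rw [abs_mul]
    have a1 : |c - q| ≤ c + B := abs_le.2 ⟨by linarith, by linarith⟩
    have a2 : |r - ρ| ≤ 3 * (t * ρ) := abs_le.2 ⟨by linarith, by linarith⟩
    exact mul_le_mul a1 a2 (abs_nonneg _) (by linarith)
  have k5 := (abs_le.1 k4).1
  have k6 : c * (6 * t) * r ≤ c * (6 * t) * (2 * ρ) := by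
    refine mul_le_mul_of_nonneg_left ?_ (by positivity)
    have : ρ * (1 + 3 * t) ≤ ρ * 2 := mul_le_mul_of_nonneg_left (by linarith) hρ0.le
    linarith
  have k7 : t * ρ * (-B) ≤ t * ρ * (c - q) := mul_le_mul_of_nonneg_left (by linarith) htρ
  have k8 : (1 - 4 * t) * (ρ * (c - q)) - (15 * c + 7 * B) * t * ρ ≤ (W - q) * r := by
    linarith
  calc _ = ((1 - 4 * t) * (ρ * (c - q)) - (15 * c + 7 * B) * t * ρ) * v ^ 2 := by ring
    _ ≤ _ := mul_le_mul_of_nonneg_right k8 (sq_nonneg _)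

/-- Pointwise localization of the energy density near the soliton. -/
lemma energy_density_ge {r ρ R ω c W B M f q κ d w w' : ℝ} (hr : 0 < r) (hR : 8 ≤ R)
    (hρ : R ^ 2 ≤ ρ) (hc : 0 < c) (hWω : ω ≤ W)
    (hW : c - W ≤ c * (1 - (ρ / r) ^ 2) ∨ c ≤ W) (hf : f ≤ q) (hq0 : 0 ≤ q) (hqB : q ≤ B)
    (hκ0 : 0 ≤ κ) (hκ1 : κ ≤ 1) (hd : |d| ≤ M) (hsupp : κ ≠ 0 ∨ d ≠ 0 → |r - ρ| ≤ 3 * R)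
    (hfar : κ ≠ 1 → q ≤ ω / 2) :
    (1 - 4 / R) * (ρ * ((κ * w' + d / R * w) ^ 2 + (c - q) * (κ * w) ^ 2))
        - (15 * c + 7 * B) / R * (ρ * (κ * w) ^ 2)
        + ω / 2 * ((1 - κ ^ 2) * (w ^ 2 * r)) - M ^ 2 / R * (w ^ 2 * r)
      ≤ (w' ^ 2 + W * w ^ 2 - f * w ^ 2) * r := by
  have hR0 : 0 < R := by linarith
  have hρ0 : 0 < ρ := lt_of_lt_of_le (by positivity) hρ
  obtain ⟨t, ht⟩ : ∃ t, t = 1 / R := ⟨_, rfl⟩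
  have ht0 : 0 < t := by rw [ht]; positivity
  have ht8 : t ≤ 1 / 8 := by rw [ht]; exact one_div_le_one_div_of_le (by norm_num) hR
  have hRt : R * t = 1 := by rw [ht]; field_simp
  have e1 : 4 / R = 4 * t := by rw [ht]; ring
  have e2 : (15 * c + 7 * B) / R = (15 * c + 7 * B) * t := by rw [ht]; ring
  have e3 : M ^ 2 / R = M ^ 2 * t := by rw [ht]; ring
  have e4 : d / R = d * t := by rw [ht]; ring
  rw [e1, e2, e3, e4]
  have hRρ : R ≤ ρ * t := by
    calc R = R ^ 2 * t := by rw [sq, mul_assoc, hRt, mul_one]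
      _ ≤ _ := mul_le_mul_of_nonneg_right hρ ht0.le
  have near : κ ≠ 0 ∨ d ≠ 0 → ρ * (1 - 3 * t) ≤ r ∧ r ≤ ρ * (1 + 3 * t) := by
    intro h
    have := abs_le.1 (hsupp h)
    constructor <;> linarith
  have kin := kinetic_density_ge (w := w) (w' := w') hr ht0 ht8 hρ0 hκ0 hκ1 hd
    fun h => (near h).1
  have pot1 : (1 - 4 * t) * (ρ * ((c - q) * (κ * w) ^ 2))
      - (15 * c + 7 * B) * t * (ρ * (κ * w) ^ 2) ≤ (W - q) * r * (κ * w) ^ 2 := by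
    by_cases h : κ = 0
    · rw [h]; simp
    · obtain ⟨h1, h2⟩ := near (Or.inl h)
      exact potential_density_ge hr ht0 ht8 hρ0 hc hW hq0 hqB h1 h2
  have hwr : 0 ≤ w ^ 2 * r := by positivity
  have pot2 : ω / 2 * ((1 - κ ^ 2) * (w ^ 2 * r)) ≤ (W - q) * ((1 - κ ^ 2) * (w ^ 2 * r)) := by
    by_cases h : κ = 1
    · rw [h]; simp
    · have h1 := hfar h
      have h2 : 0 ≤ 1 - κ ^ 2 := sub_nonneg.2 (pow_le_one₀ hκ0 hκ1)
      exact mul_le_mul_of_nonneg_right (by linarith) (mul_nonneg h2 hwr)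
  have pot3 : (W - q) * (w ^ 2 * r) ≤ (W - f) * (w ^ 2 * r) :=
    mul_le_mul_of_nonneg_right (by linarith) hwr
  linarith

/-- Smooth cutoffs equal to `1` on `[-2, 2]` and to `0` outside `(-3, 3)`. -/
structure IsCutoff (χ : ℝ → ℝ) : Prop where
  contDiff : ContDiff ℝ (⊤ : ℕ∞) χ
  mem_Icc : ∀ s, χ s ∈ Set.Icc (0:ℝ) 1
  eq_one_of_mem : ∀ s ∈ Set.Icc (-2:ℝ) 2, χ s = 1
  eq_zero_of_notMem : ∀ s ∉ Set.Ioo (-3:ℝ) 3, χ s = 0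

namespace IsCutoff

variable {χ : ℝ → ℝ}

lemma eq_one (h : IsCutoff χ) {x R : ℝ} (hR : 0 < R) (hx : |x| ≤ 2 * R) : χ (x / R) = 1 := by
  have := abs_le.1 hx
  refine h.eq_one_of_mem _ ⟨?_, ?_⟩
  · rw [le_div_iff₀ hR]; linarith
  · rw [div_le_iff₀ hR]; linarith

lemma eq_zero (h : IsCutoff χ) {x R : ℝ} (hR : 0 < R) (hx : 3 * R ≤ |x|) : χ (x / R) = 0 := by
  refine h.eq_zero_of_notMem _ fun hs => ?_
  have h1 : |x / R| < 3 := abs_lt.2 hs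
  rw [abs_div, abs_of_pos hR, div_lt_iff₀ hR] at h1
  linarith

lemma deriv_eq_zero (h : IsCutoff χ) {x R : ℝ} (hR : 0 < R) (hx : 3 * R ≤ |x|) :
    deriv χ (x / R) = 0 := by
  refine IsLocalMin.deriv_eq_zero (Eventually.of_forall fun y => ?_)
  rw [h.eq_zero hR hx]
  exact (h.mem_Icc y).1

lemma continuous (h : IsCutoff χ) : Continuous χ := h.contDiff.continuous

lemma differentiable (h : IsCutoff χ) : Differentiable ℝ χ := h.contDiff.differentiable (by simp)

lemma continuous_deriv (h : IsCutoff χ) : Continuous (deriv χ) :=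
  h.contDiff.continuous_deriv (by simp)

lemma exists_deriv_bound (h : IsCutoff χ) : ∃ M, ∀ s, |deriv χ s| ≤ M := by
  have hc : HasCompactSupport (deriv χ) := by
    refine HasCompactSupport.intro (isCompact_Icc (a := (-3:ℝ)) (b := 3)) fun x hx => ?_
    have h3 : 3 * 1 ≤ |x| := by
      by_contra! h1
      rw [mul_one] at h1
      exact hx ⟨(abs_lt.1 h1).1.le, (abs_lt.1 h1).2.le⟩
    simpa using h.deriv_eq_zero one_pos h3
  obtain ⟨M, hM⟩ := hc.exists_bound_of_continuous h.continuous_deriv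
  exact ⟨M, hM⟩

lemma hasDerivAt_comp (h : IsCutoff χ) (ρ R r : ℝ) :
    HasDerivAt (fun t => χ ((t - ρ) / R)) (deriv χ ((r - ρ) / R) / R) r := by
  have h1 : HasDerivAt (fun t : ℝ => (t - ρ) / R) (1 / R) r :=
    ((hasDerivAt_id r).sub_const ρ).div_const R
  refine ((h.differentiable ((r - ρ) / R)).hasDerivAt.comp r h1).congr_deriv ?_
  ring

lemma far_of_lt_half {ρ R r : ℝ} (hR : 3 * R ≤ ρ / 2) (hr : r < ρ / 2) : 3 * R ≤ |r - ρ| := by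
  rw [abs_sub_comm]
  exact le_trans (by linarith) (le_abs_self _)

lemma le_two_mul {ρ R r : ℝ} (hR : 3 * R ≤ ρ / 2) (hr : ¬ 3 * R ≤ |r - ρ|) :
    ρ / 2 ≤ r ∧ r ≤ 2 * ρ := by
  have := abs_lt.1 (not_le.1 hr)
  constructor <;> linarith

/-- Multiplying a function on the half-line by a cutoff gives a `C¹` function on the line. -/
lemma mul_localized (h : IsCutoff χ) {ρ R : ℝ} {w : ℝ → ℝ} (hR : 0 < R) (hRρ : 3 * R ≤ ρ / 2)
    (hw : ContDiffOn ℝ 1 w (Set.Ioi 0)) :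
    ContDiff ℝ 1 (fun r => χ ((r - ρ) / R) * w r)
      ∧ HasCompactSupport (fun r => χ ((r - ρ) / R) * w r)
      ∧ (∀ r > 0, deriv (fun r => χ ((r - ρ) / R) * w r) r
        = χ ((r - ρ) / R) * deriv w r + deriv χ ((r - ρ) / R) / R * w r)
      ∧ ∀ r ≤ 0, deriv (fun r => χ ((r - ρ) / R) * w r) r = 0 := by
  have hz : ∀ r < ρ / 2, (fun r => χ ((r - ρ) / R) * w r) =ᶠ[nhds r] fun _ => 0 := by
    intro r hr
    filter_upwards [Iio_mem_nhds hr] with y hy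
    rw [h.eq_zero hR (far_of_lt_half hRρ hy), zero_mul]
  have hwr : ∀ r > 0, ContDiffAt ℝ 1 w r := fun r hr => hw.contDiffAt (Ioi_mem_nhds hr)
  refine ⟨contDiff_iff_contDiffAt.2 fun r => ?_, ?_, fun r hr => ?_, fun r hr => ?_⟩
  · rcases lt_or_ge r (ρ / 2) with h1 | h1
    · exact contDiffAt_const.congr_of_eventuallyEq (hz r h1)
    · have h2 : ContDiff ℝ 1 fun r => χ ((r - ρ) / R) :=
        (h.contDiff.of_le (by exact_mod_cast le_top)).comp
          ((contDiff_id.sub contDiff_const).div_const R)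
      exact h2.contDiffAt.mul (hwr r (by linarith))
  · refine HasCompactSupport.intro (isCompact_Icc (a := ρ / 2) (b := 2 * ρ)) fun r hr => ?_
    have : 3 * R ≤ |r - ρ| := by
      by_contra h1
      exact hr (le_two_mul hRρ h1)
    rw [h.eq_zero hR this, zero_mul]
  · have h1 := ((hwr r hr).differentiableAt (by simp)).hasDerivAt
    rw [((h.hasDerivAt_comp ρ R r).fun_mul h1).deriv]
    ring
  · rw [(hz r (by linarith)).deriv_eq, deriv_const]

end IsCutoff

lemma integrableOn_of_energy {w : ℝ → ℝ} (hw : ContDiffOn ℝ 1 w (Set.Ioi 0))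
    (hI : IntegrableOn
      (fun r => (deriv w r ^ 2 + w r ^ 2 + (r ^ 2)⁻¹ * w r ^ 2) * r) (Set.Ioi 0)) :
    IntegrableOn (fun r => deriv w r ^ 2 * r) (Set.Ioi 0)
      ∧ IntegrableOn (fun r => w r ^ 2 * r) (Set.Ioi 0)
      ∧ IntegrableOn (fun r => (r ^ 2)⁻¹ * w r ^ 2 * r) (Set.Ioi 0) := by
  have c1 := hw.continuousOn
  have c2 : ContinuousOn (deriv w) (Set.Ioi 0) := hw.continuousOn_deriv_of_isOpen isOpen_Ioi le_rfl
  have c3 : ContinuousOn (fun r : ℝ => (r ^ 2)⁻¹) (Set.Ioi 0) :=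
    (continuousOn_id.pow 2).inv₀ fun r hr => pow_ne_zero 2 (ne_of_gt hr)
  have key : ∀ F : ℝ → ℝ, ContinuousOn F (Set.Ioi 0) →
      (∀ r > 0, 0 ≤ F r ∧ F r ≤ (deriv w r ^ 2 + w r ^ 2 + (r ^ 2)⁻¹ * w r ^ 2) * r) →
      IntegrableOn F (Set.Ioi 0) := fun F hF hb =>
    hI.mono' (hF.aestronglyMeasurable measurableSet_Ioi)
      ((ae_restrict_mem measurableSet_Ioi).mono fun r hr => by
        rw [Real.norm_of_nonneg (hb r hr).1]
        exact (hb r hr).2)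
  have hpos : ∀ r : ℝ, 0 < r → 0 ≤ deriv w r ^ 2 * r ∧ 0 ≤ w r ^ 2 * r
      ∧ 0 ≤ (r ^ 2)⁻¹ * w r ^ 2 * r := fun r hr => ⟨by positivity, by positivity, by positivity⟩
  refine ⟨key _ ((c2.pow 2).mul continuousOn_id) fun r hr => ?_,
    key _ ((c1.pow 2).mul continuousOn_id) fun r hr => ?_,
    key _ ((c3.mul (c1.pow 2)).mul continuousOn_id) fun r hr => ?_⟩ <;>
  · obtain ⟨h1, h2, h3⟩ := hpos r hr
    refine ⟨by assumption, ?_⟩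
    linarith

lemma integrableOn_mul_of_support {w g : ℝ → ℝ} {ρ : ℝ} (hw : ContinuousOn w (Set.Ioi 0))
    (hg : Continuous g) (hρ : 0 < ρ) (h0 : ∀ r, r ∉ Set.Icc (ρ / 2) (2 * ρ) → g r = 0) :
    IntegrableOn (fun r => w r * g r * r) (Set.Ioi 0) := by
  have hs : Set.Icc (ρ / 2) (2 * ρ) ⊆ Set.Ioi 0 := fun r hr =>
    lt_of_lt_of_le (by linarith : 0 < ρ / 2) hr.1
  have h1 : IntegrableOn (fun r => w r * g r * r) (Set.Icc (ρ / 2) (2 * ρ)) :=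
    (((hw.mono hs).mul hg.continuousOn).mul continuousOn_id).integrableOn_compact isCompact_Icc
  exact h1.of_forall_sdiff_eq_zero measurableSet_Ioi fun r hr => by
    rw [h0 r hr.2]; ring

/-- The mode estimate `sq_mode_le` for a product cutoff. -/
lemma sq_cutoff_mode_le {χ w φ g h : ℝ → ℝ} (hχ : IsCutoff χ) {ρ R C : ℝ} (hR : 0 < R)
    (hRρ : 3 * R ≤ ρ / 2) (hw : ContDiffOn ℝ 1 w (Set.Ioi 0))
    (hE : IntegrableOn (fun r => w r ^ 2 * r) (Set.Ioi 0)) (hh : Integrable fun x => h x ^ 2)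
    (hφ : Continuous φ) (hg : Continuous g)
    (hg0 : ∀ r, r ∉ Set.Icc (ρ / 2) (2 * ρ) → g r = 0)
    (h0 : ∫ r in Set.Ioi (0:ℝ), w r * g r * r = 0)
    (hd : ∀ r > 0, |χ ((r - ρ) / R) * φ r * ρ - g r * r| ≤ C * ρ / R * h (r - ρ)) :
    ρ * (∫ r, χ ((r - ρ) / R) * w r * φ r) ^ 2
      ≤ 2 * C ^ 2 / R ^ 2 * (∫ x, h x ^ 2) * ∫ r in Set.Ioi (0:ℝ), w r ^ 2 * r := by
  obtain ⟨hV1, hV2, -, -⟩ := hχ.mul_localized hR hRρ hw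
  have hρ : 0 < ρ := by linarith
  have hz : ∀ r < ρ / 2, χ ((r - ρ) / R) = 0 := fun r hr =>
    hχ.eq_zero hR (IsCutoff.far_of_lt_half hRρ hr)
  refine sq_mode_le (V := fun r => χ ((r - ρ) / R) * w r) (η := fun r => χ ((r - ρ) / R))
    hρ hE hh (fun _ => rfl) (fun r hr => ?_) ?_
    (integrableOn_mul_of_support hw.continuousOn hg hρ hg0) h0 (fun r _ hr => ?_) hd
  · rw [hz r (by linarith), zero_mul]
  · exact (hV1.continuous.mul hφ).integrable_of_hasCompactSupport hV2.mul_right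
  · rw [hz r hr, hg0 r fun h => absurd h.1 (not_le.2 hr)]
    ring

lemma abs_cutoff_sub_le {ρ R r κ κ' : ℝ} (hR : 1 ≤ R) (hRρ : R ≤ ρ) (hr : 0 < r)
    (hκ : κ ∈ Set.Icc (0:ℝ) 1) (hκ' : κ' ∈ Set.Icc (0:ℝ) 1)
    (h1 : |r - ρ| ≤ 2 * R → κ = 1 ∧ κ' = 1) (h2 : κ' ≠ 0 → r ≤ 2 * ρ) :
    |κ * ρ - κ' * r| ≤ 2 * ρ / R * |r - ρ| := by
  have hR0 : 0 < R := by linarith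
  have hρ0 : 0 < ρ := by linarith
  rcases le_or_gt |r - ρ| (2 * R) with h | h
  · obtain ⟨rfl, rfl⟩ := h1 h
    rw [one_mul, one_mul, abs_sub_comm]
    refine le_mul_of_one_le_left (abs_nonneg _) ?_
    rw [le_div_iff₀ hR0]
    linarith
  · have h3 : κ' * r ≤ 2 * ρ := by
      by_cases h4 : κ' = 0
      · rw [h4]; linarith
      · exact (mul_le_of_le_one_left hr.le hκ'.2).trans (h2 h4)
    have h4 : κ * ρ ≤ ρ := mul_le_of_le_one_left hρ0.le hκ.2
    have h5 : 0 ≤ κ * ρ := mul_nonneg hκ.1 hρ0.le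
    have h6 : 0 ≤ κ' * r := mul_nonneg hκ'.1 hr.le
    have h7 : |κ * ρ - κ' * r| ≤ 2 * ρ := abs_le.2 ⟨by linarith, by linarith⟩
    refine h7.trans ?_
    calc 2 * ρ = 2 * ρ / R * R := by field_simp
      _ ≤ _ := mul_le_mul_of_nonneg_left (by linarith) (by positivity)

lemma sech_rpow_le {m β β₀ : ℝ} (hm : 0 < m) (hβ₀ : 0 < β₀) (hβ : β₀ ≤ β) (x : ℝ) :
    sech (β * x) ^ m ≤ sech (β₀ * x) ^ m := by
  refine Real.rpow_le_rpow (sech_pos _).le (sech_antitone ?_) hm.le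
  rw [abs_mul, abs_mul, abs_of_pos hβ₀, abs_of_pos (hβ₀.trans_le hβ)]
  gcongr

lemma continuous_comp_shift {f : ℝ → ℝ} (hf : Continuous f) (β ρ : ℝ) :
    Continuous fun r => f (β * (r - ρ)) :=
  hf.comp (continuous_const.mul (continuous_id.sub continuous_const))

lemma sq_sech_mode_le {χ w : ℝ → ℝ} (hχ : IsCutoff χ) {ρ R l m β β₀ q : ℝ} (hR : 1 ≤ R)
    (hRρ : 3 * R ≤ ρ / 2) (hRl : R ≤ l) (hlρ : 3 * l ≤ ρ / 2) (hm : 0 < m) (hβ₀ : 0 < β₀)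
    (hβ : β₀ ≤ β) (hq : 0 < q) (hw : ContDiffOn ℝ 1 w (Set.Ioi 0))
    (hE : IntegrableOn (fun r => w r ^ 2 * r) (Set.Ioi 0))
    (h0 : ∫ r in Set.Ioi (0:ℝ),
      w r * (χ ((r - ρ) / l) ^ q * sech (β * (r - ρ)) ^ (m + 1)) * r = 0) :
    ρ * (∫ r, χ ((r - ρ) / R) * w r * sech (β * (r - ρ)) ^ (m + 1)) ^ 2
      ≤ 2 * 2 ^ 2 / R ^ 2 * (∫ x, ((1 + |x|) * sech (β₀ * x) ^ m) ^ 2)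
        * ∫ r in Set.Ioi (0:ℝ), w r ^ 2 * r := by
  have hR0 : 0 < R := by linarith
  have hl0 : 0 < l := by linarith
  have hρ : 0 < ρ := by linarith
  have hcs : Continuous fun r => sech (β * (r - ρ)) ^ (m + 1) :=
    continuous_comp_shift (continuous_sech_rpow (m + 1)) β ρ
  have hcχ : Continuous fun r => χ ((r - ρ) / l) :=
    hχ.continuous.comp ((continuous_id.sub continuous_const).div_const l)
  refine sq_cutoff_mode_le (g := fun r => χ ((r - ρ) / l) ^ q * sech (β * (r - ρ)) ^ (m + 1))
    hχ hR0 hRρ hw hE (integrable_sq_weight hm hβ₀) hcs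
    ((hcχ.rpow_const fun _ => Or.inr hq.le).mul hcs) (fun r hr => ?_) h0 fun r hr => ?_
  · have : 3 * l ≤ |r - ρ| := by
      by_contra h1
      exact hr (IsCutoff.le_two_mul hlρ h1)
    rw [hχ.eq_zero hl0 this, Real.zero_rpow hq.ne', zero_mul]
  · have h1 : |χ ((r - ρ) / R) * ρ - χ ((r - ρ) / l) ^ q * r| ≤ 2 * ρ / R * |r - ρ| := by
      refine abs_cutoff_sub_le hR (by linarith) hr (hχ.mem_Icc _)
        ⟨Real.rpow_nonneg (hχ.mem_Icc _).1 _,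
          Real.rpow_le_one (hχ.mem_Icc _).1 (hχ.mem_Icc _).2 hq.le⟩ (fun h => ?_) fun h => ?_
      · rw [hχ.eq_one hR0 h, hχ.eq_one hl0 (by linarith), Real.one_rpow]
        exact ⟨rfl, rfl⟩
      · by_contra h3
        refine h ?_
        rw [hχ.eq_zero hl0, Real.zero_rpow hq.ne']
        by_contra h4
        exact h3 (IsCutoff.le_two_mul hlρ h4).2
    have h2 : sech (β * (r - ρ)) ^ (m + 1) ≤ sech (β₀ * (r - ρ)) ^ m :=
      (Real.rpow_le_rpow_of_exponent_ge (sech_pos _) (sech_le_one _) (by linarith)).trans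
        (sech_rpow_le hm hβ₀ hβ _)
    have h3 : 0 ≤ sech (β * (r - ρ)) ^ (m + 1) := Real.rpow_nonneg (sech_pos _).le _
    calc |χ ((r - ρ) / R) * sech (β * (r - ρ)) ^ (m + 1) * ρ
          - χ ((r - ρ) / l) ^ q * sech (β * (r - ρ)) ^ (m + 1) * r|
        = |χ ((r - ρ) / R) * ρ - χ ((r - ρ) / l) ^ q * r| * sech (β * (r - ρ)) ^ (m + 1) := by
          rw [← abs_of_nonneg h3, ← abs_mul, abs_of_nonneg h3]; congr 1; ring
      _ ≤ 2 * ρ / R * |r - ρ| * sech (β₀ * (r - ρ)) ^ m :=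
          mul_le_mul h1 h2 h3 (by positivity)
      _ = 2 * ρ / R * (|r - ρ| * sech (β₀ * (r - ρ)) ^ m) := by ring
      _ ≤ 2 * ρ / R * ((1 + |r - ρ|) * sech (β₀ * (r - ρ)) ^ m) := by
          have := Real.rpow_nonneg (sech_pos (β₀ * (r - ρ))).le m
          gcongr
          linarith

lemma sq_tanh_mode_le {χ w : ℝ → ℝ} (hχ : IsCutoff χ)
    {ρ R l m β β₀ M n n₀ a a₁ b b₁ D D₁ : ℝ} (hR : 1 ≤ R)
    (hRρ : 3 * R ≤ ρ / 2) (hRl : R ≤ l) (hlρ : 3 * l ≤ ρ / 2) (hm : 0 < m) (hβ₀ : 0 < β₀)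
    (hβ : β₀ ≤ β) (hM : ∀ s, |deriv χ s| ≤ M) (hn₀ : 0 < n₀) (hn : n₀ ≤ n)
    (ha₀ : 0 ≤ a) (ha : a ≤ a₁) (hb₀ : 0 ≤ b) (hb : b ≤ b₁) (hD₀ : 0 ≤ D) (hD : D ≤ D₁ / R)
    (hw : ContDiffOn ℝ 1 w (Set.Ioi 0))
    (hE : IntegrableOn (fun r => w r ^ 2 * r) (Set.Ioi 0))
    (h0 : ∫ r in Set.Ioi (0:ℝ),
      w r * (χ ((r - ρ) / l) * (sech (β * (r - ρ)) ^ m * Real.tanh (β * (r - ρ)))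
        - deriv χ ((r - ρ) / l) / l / n * sech (β * (r - ρ)) ^ m
        - D / n * χ ((r - ρ) / l) * sech (β * (r - ρ)) ^ m
          * (a - (r - ρ) * Real.tanh (β * (r - ρ)) * b)) * r = 0) :
    ρ * (∫ r, χ ((r - ρ) / R) * w r
        * (sech (β * (r - ρ)) ^ m * Real.tanh (β * (r - ρ)))) ^ 2
      ≤ 2 * (2 + 2 * M / n₀ + 2 * D₁ / n₀ * (a₁ + b₁)) ^ 2 / R ^ 2
        * (∫ x, ((1 + |x|) * sech (β₀ * x) ^ m) ^ 2)
        * ∫ r in Set.Ioi (0:ℝ), w r ^ 2 * r := by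
  have hR0 : 0 < R := by linarith
  have hl0 : 0 < l := by linarith
  have hρ : 0 < ρ := by linarith
  have hn0 : 0 < n := by linarith
  have hM0 : 0 ≤ M := (abs_nonneg _).trans (hM 0)
  have hD₁ : 0 ≤ D₁ := by
    have := hD₀.trans hD
    rw [le_div_iff₀ hR0] at this
    linarith
  have hcs : Continuous fun r => sech (β * (r - ρ)) ^ m :=
    continuous_comp_shift (continuous_sech_rpow m) β ρ
  have hct : Continuous fun r => Real.tanh (β * (r - ρ)) :=
    continuous_comp_shift continuous_tanh' β ρ
  have hcx : Continuous fun r : ℝ => (r - ρ) / l :=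
    (continuous_id.sub continuous_const).div_const l
  have hcχ : Continuous fun r => χ ((r - ρ) / l) := hχ.continuous.comp hcx
  have hcd : Continuous fun r => deriv χ ((r - ρ) / l) := hχ.continuous_deriv.comp hcx
  refine sq_cutoff_mode_le (g := fun r =>
      χ ((r - ρ) / l) * (sech (β * (r - ρ)) ^ m * Real.tanh (β * (r - ρ)))
        - deriv χ ((r - ρ) / l) / l / n * sech (β * (r - ρ)) ^ m
        - D / n * χ ((r - ρ) / l) * sech (β * (r - ρ)) ^ m
          * (a - (r - ρ) * Real.tanh (β * (r - ρ)) * b))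
    hχ hR0 hRρ hw hE (integrable_sq_weight hm hβ₀) (hcs.mul hct)
    (((hcχ.mul (hcs.mul hct)).sub (((hcd.div_const l).div_const n).mul hcs)).sub
      (((continuous_const.mul hcχ).mul hcs).mul (continuous_const.sub
        (((continuous_id.sub continuous_const).mul hct).mul continuous_const)))) (fun r hr => ?_) h0 fun r hr => ?_
  · have : 3 * l ≤ |r - ρ| := by
      by_contra h1
      exact hr (IsCutoff.le_two_mul hlρ h1)
    rw [hχ.eq_zero hl0 this, hχ.deriv_eq_zero hl0 this]
    ring
  · obtain ⟨x, hx⟩ : ∃ x, x = r - ρ := ⟨_, rfl⟩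
    obtain ⟨κ, hκ⟩ : ∃ κ, κ = χ ((r - ρ) / R) := ⟨_, rfl⟩
    obtain ⟨κ', hκ'⟩ : ∃ κ', κ' = χ ((r - ρ) / l) := ⟨_, rfl⟩
    obtain ⟨δ, hδ⟩ : ∃ δ, δ = deriv χ ((r - ρ) / l) := ⟨_, rfl⟩
    obtain ⟨S, hS⟩ : ∃ S, S = sech (β * (r - ρ)) ^ m := ⟨_, rfl⟩
    obtain ⟨T, hT⟩ : ∃ T, T = Real.tanh (β * (r - ρ)) := ⟨_, rfl⟩
    have h1 : |κ * ρ - κ' * r| ≤ 2 * ρ / R * |x| := by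
      rw [hκ, hκ', hx]
      refine abs_cutoff_sub_le hR (by linarith) hr (hχ.mem_Icc _) (hχ.mem_Icc _)
        (fun h => ?_) fun h => ?_
      · rw [hχ.eq_one hR0 h, hχ.eq_one hl0 (by linarith)]
        exact ⟨rfl, rfl⟩
      · by_contra h3
        refine h (hχ.eq_zero hl0 ?_)
        by_contra h4
        exact h3 (IsCutoff.le_two_mul hlρ h4).2
    have hκ0 : 0 ≤ κ' := hκ' ▸ (hχ.mem_Icc _).1
    have hκ1 : κ' * r ≤ 2 * ρ := by
      by_cases h3 : 3 * l ≤ |r - ρ|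
      · rw [hκ', hχ.eq_zero hl0 h3]; linarith
      · exact (mul_le_of_le_one_left hr.le (hκ' ▸ (hχ.mem_Icc _).2)).trans
          (IsCutoff.le_two_mul hlρ h3).2
    have hδ1 : |δ| * r ≤ M * (2 * ρ) := by
      by_cases h3 : 3 * l ≤ |r - ρ|
      · rw [hδ, hχ.deriv_eq_zero hl0 h3, abs_zero, zero_mul]; positivity
      · exact mul_le_mul (hδ ▸ hM _) (IsCutoff.le_two_mul hlρ h3).2 hr.le hM0
    have hS0 : 0 ≤ S := hS ▸ Real.rpow_nonneg (sech_pos _).le _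
    have hT1 : |T| ≤ 1 := by
      rw [hT]; exact (Real.abs_tanh_lt_one _).le
    have hS1 : S ≤ sech (β₀ * x) ^ m := by
      rw [hS, hx]; exact sech_rpow_le hm hβ₀ hβ _
    rw [← hκ, ← hκ', ← hδ, ← hS, ← hT, ← hx]
    have b1 : |(κ * ρ - κ' * r) * T| ≤ 2 * ρ / R * |x| := by
      rw [abs_mul]
      exact (mul_le_of_le_one_right (abs_nonneg _) hT1).trans h1
    have b2 : |δ / l / n * r| ≤ 2 * M / n₀ * (ρ / R) := by
      have e : |δ / l / n * r| = |δ| * r / (l * n) := by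
        rw [abs_mul, abs_div, abs_div, abs_of_pos hl0, abs_of_pos hn0, abs_of_pos hr]
        field_simp
      rw [e]
      calc |δ| * r / (l * n) ≤ M * (2 * ρ) / (R * n₀) := by gcongr
        _ = _ := by field_simp
    have b3 : |D / n * κ' * (a - x * T * b) * r| ≤ 2 * D₁ / n₀ * (a₁ + b₁) * (ρ / R) * (1 + |x|) := by
      have e1 : |a - x * T * b| ≤ (a₁ + b₁) * (1 + |x|) := by
        have e2 : |x * T * b| ≤ |x| * b₁ := by
          rw [abs_mul, abs_mul, abs_of_nonneg hb₀]
          exact mul_le_mul (mul_le_of_le_one_right (abs_nonneg _) hT1) hb hb₀ (abs_nonneg _)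
        have e3 : |a - x * T * b| ≤ a + |x * T * b| := by
          refine (abs_sub _ _).trans ?_
          rw [abs_of_nonneg ha₀]
        have e4 : 0 ≤ a₁ * |x| := mul_nonneg (ha₀.trans ha) (abs_nonneg _)
        have e5 : 0 ≤ b₁ := hb₀.trans hb
        linarith
      have e5 : D / n * (κ' * r) ≤ D₁ / R / n₀ * (2 * ρ) := by gcongr
      calc |D / n * κ' * (a - x * T * b) * r| = D / n * (κ' * r) * |a - x * T * b| := by
            rw [abs_mul, abs_mul, abs_of_pos hr,
              abs_of_nonneg (mul_nonneg (div_nonneg hD₀ hn0.le) hκ0)]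
            ring
        _ ≤ D₁ / R / n₀ * (2 * ρ) * ((a₁ + b₁) * (1 + |x|)) :=
            mul_le_mul e5 e1 (abs_nonneg _) (by positivity)
        _ = _ := by ring
    have b4 : |(κ * ρ - κ' * r) * T + δ / l / n * r + D / n * κ' * (a - x * T * b) * r|
        ≤ (2 + 2 * M / n₀ + 2 * D₁ / n₀ * (a₁ + b₁)) * ρ / R * (1 + |x|) := by
      refine (abs_add_three _ _ _).trans ?_
      have c1 : 2 * ρ / R * |x| ≤ 2 * (ρ / R) * (1 + |x|) := by
        calc 2 * ρ / R * |x| = 2 * (ρ / R) * |x| := by ring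
          _ ≤ _ := mul_le_mul_of_nonneg_left (by linarith) (by positivity)
      have c2 : 2 * M / n₀ * (ρ / R) ≤ 2 * M / n₀ * (ρ / R) * (1 + |x|) :=
        le_mul_of_one_le_right (by positivity) (by linarith [abs_nonneg x])
      calc _ ≤ 2 * (ρ / R) * (1 + |x|) + 2 * M / n₀ * (ρ / R) * (1 + |x|)
            + 2 * D₁ / n₀ * (a₁ + b₁) * (ρ / R) * (1 + |x|) := by linarith
        _ = _ := by ring
    calc |κ * (S * T) * ρ - (κ' * (S * T) - δ / l / n * S
            - D / n * κ' * S * (a - x * T * b)) * r|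
        = |((κ * ρ - κ' * r) * T + δ / l / n * r + D / n * κ' * (a - x * T * b) * r)| * S := by
          rw [← abs_of_nonneg hS0, ← abs_mul, abs_of_nonneg hS0]; congr 1; ring
      _ ≤ (2 + 2 * M / n₀ + 2 * D₁ / n₀ * (a₁ + b₁)) * ρ / R * (1 + |x|)
          * sech (β₀ * x) ^ m := by
          refine mul_le_mul b4 hS1 hS0 ((abs_nonneg _).trans b4)
      _ = _ := by ring

lemma integral_four_terms {α : Type*} [MeasurableSpace α] {μ : Measure α} {f g h k : α → ℝ}
    (a b c d : ℝ) (hf : Integrable f μ) (hg : Integrable g μ) (hh : Integrable h μ)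
    (hk : Integrable k μ) :
    Integrable (fun x => a * f x - b * g x + c * h x - d * k x) μ
      ∧ ∫ x, (a * f x - b * g x + c * h x - d * k x) ∂μ
        = a * (∫ x, f x ∂μ) - b * (∫ x, g x ∂μ) + c * (∫ x, h x ∂μ) - d * ∫ x, k x ∂μ := by
  have h1 : Integrable (fun x => a * f x - b * g x) μ := (hf.const_mul a).sub (hg.const_mul b)
  have h2 : Integrable (fun x => a * f x - b * g x + c * h x) μ := h1.add (hh.const_mul c)
  refine ⟨h2.sub (hk.const_mul d), ?_⟩
  rw [integral_sub h2 (hk.const_mul d), integral_add h1 (hh.const_mul c),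
    integral_sub (hf.const_mul a) (hg.const_mul b)]
  simp only [integral_const_mul]

lemma integral_energy_ge {χ w W f q : ℝ → ℝ} (hχ : IsCutoff χ) {ρ R ω c B M : ℝ} (hR : 8 ≤ R)
    (hρ : R ^ 2 ≤ ρ) (hRρ : 3 * R ≤ ρ / 2) (hc : 0 < c) (hM : ∀ s, |deriv χ s| ≤ M)
    (hw : ContDiffOn ℝ 1 w (Set.Ioi 0))
    (hE : IntegrableOn (fun r => w r ^ 2 * r) (Set.Ioi 0))
    (hI : IntegrableOn (fun r => (deriv w r ^ 2 + W r * w r ^ 2 - f r * w r ^ 2) * r) (Set.Ioi 0))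
    (hWω : ∀ r > 0, ω ≤ W r)
    (hW : ∀ r > 0, c - W r ≤ c * (1 - (ρ / r) ^ 2) ∨ c ≤ W r) (hf : ∀ r > 0, f r ≤ q r)
    (hq : Continuous q) (hq0 : ∀ r, 0 ≤ q r) (hqB : ∀ r, q r ≤ B)
    (hfar : ∀ r, 2 * R < |r - ρ| → q r ≤ ω / 2) :
    (1 - 4 / R) * (ρ * ∫ r, (deriv (fun r => χ ((r - ρ) / R) * w r) r ^ 2
        + (c - q r) * (χ ((r - ρ) / R) * w r) ^ 2))
      - (15 * c + 7 * B) / R * (ρ * ∫ r, (χ ((r - ρ) / R) * w r) ^ 2)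
      + ω / 2 * ((∫ r in Set.Ioi (0:ℝ), w r ^ 2 * r)
        - ∫ r in Set.Ioi (0:ℝ), χ ((r - ρ) / R) ^ 2 * (w r ^ 2 * r))
      - M ^ 2 / R * (∫ r in Set.Ioi (0:ℝ), w r ^ 2 * r)
      ≤ ∫ r in Set.Ioi (0:ℝ), (deriv w r ^ 2 + W r * w r ^ 2 - f r * w r ^ 2) * r := by
  have hR0 : 0 < R := by linarith
  obtain ⟨hV1, hV2, hV3, hV4⟩ := hχ.mul_localized hR0 hRρ hw
  set V := fun r => χ ((r - ρ) / R) * w r with hV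
  have hz : ∀ r ≤ 0, V r = 0 := fun r hr => by
    simp only [hV]
    rw [hχ.eq_zero hR0 (IsCutoff.far_of_lt_half hRρ (by linarith)), zero_mul]
  have hcV' : Continuous (deriv V) := hV1.continuous_deriv le_rfl
  have i2 : Integrable fun r => V r ^ 2 := by
    refine (hV1.continuous.pow 2).integrable_of_hasCompactSupport ?_
    simpa only [pow_two] using hV2.mul_right (f' := V)
  have i1 : Integrable fun r => deriv V r ^ 2 + (c - q r) * V r ^ 2 := by
    refine Integrable.add ?_ ?_
    · refine (hcV'.pow 2).integrable_of_hasCompactSupport ?_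
      simpa only [pow_two] using hV2.deriv.mul_right (f' := deriv V)
    · refine ((continuous_const.sub hq).mul (hV1.continuous.pow 2)).integrable_of_hasCompactSupport
        ?_
      refine HasCompactSupport.mul_left ?_
      simpa only [pow_two] using hV2.mul_right (f' := V)
  have hcχ : Continuous fun r => χ ((r - ρ) / R) :=
    hχ.continuous.comp ((continuous_id.sub continuous_const).div_const R)
  have hκ2 : ∀ r, χ ((r - ρ) / R) ^ 2 ≤ 1 := fun r =>
    pow_le_one₀ (hχ.mem_Icc _).1 (hχ.mem_Icc _).2
  have i3 : IntegrableOn (fun r => χ ((r - ρ) / R) ^ 2 * (w r ^ 2 * r)) (Set.Ioi 0) :=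
    hE.bdd_mul (c := 1) (hcχ.pow 2).aestronglyMeasurable (ae_of_all _ fun r => by
      rw [Real.norm_of_nonneg (sq_nonneg _)]; exact hκ2 r)
  obtain ⟨j1, j2⟩ := integral_four_terms (μ := volume.restrict (Set.Ioi (0:ℝ)))
    ((1 - 4 / R) * ρ) ((15 * c + 7 * B) / R * ρ) (ω / 2) (M ^ 2 / R) i1.integrableOn
    i2.integrableOn (hE.sub i3) hE
  have key := setIntegral_mono_on j1 hI measurableSet_Ioi fun r (hr : 0 < r) => by
    have := energy_density_ge (w := w r) (w' := deriv w r) hr hR hρ hc (hWω r hr) (hW r hr)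
      (hf r hr) (hq0 r) (hqB r) (hχ.mem_Icc ((r - ρ) / R)).1 (hχ.mem_Icc ((r - ρ) / R)).2
      (hM ((r - ρ) / R)) (fun h => by
        by_contra! h1
        rcases h with h | h
        · exact h (hχ.eq_zero hR0 h1.le)
        · exact h (hχ.deriv_eq_zero hR0 h1.le)) (fun h => hfar r (by
        by_contra! h1
        exact h (hχ.eq_one hR0 h1)))
    rw [← hV3 r hr] at this
    refine le_trans (le_of_eq ?_) this
    simp only [Pi.sub_apply, hV]
    ring
  rw [j2] at key
  have s1 : ∫ r in Set.Ioi (0:ℝ), (deriv V r ^ 2 + (c - q r) * V r ^ 2)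
      = ∫ r, (deriv V r ^ 2 + (c - q r) * V r ^ 2) :=
    setIntegral_eq_integral_of_forall_compl_eq_zero fun r hr => by
      have h0 : r ≤ 0 := not_lt.1 hr
      rw [hV4 r h0, hz r h0]; ring
  have s2 : ∫ r in Set.Ioi (0:ℝ), V r ^ 2 = ∫ r, V r ^ 2 :=
    setIntegral_eq_integral_of_forall_compl_eq_zero fun r hr => by
      have h0 : r ≤ 0 := not_lt.1 hr
      rw [hz r h0]; ring
  have s3 : ∫ r in Set.Ioi (0:ℝ), ((fun r => w r ^ 2 * r)
        - fun r => χ ((r - ρ) / R) ^ 2 * (w r ^ 2 * r)) r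
      = (∫ r in Set.Ioi (0:ℝ), w r ^ 2 * r)
        - ∫ r in Set.Ioi (0:ℝ), χ ((r - ρ) / R) ^ 2 * (w r ^ 2 * r) := integral_sub hE i3
  rw [s1, s2, s3] at key
  linarith

lemma localized_mass_bounds {χ w : ℝ → ℝ} (hχ : IsCutoff χ) {ρ R : ℝ} (hR : 0 < R)
    (hRρ : 3 * R ≤ ρ / 2) (hw : ContDiffOn ℝ 1 w (Set.Ioi 0))
    (hE : IntegrableOn (fun r => w r ^ 2 * r) (Set.Ioi 0)) :
    ρ * (∫ r, (χ ((r - ρ) / R) * w r) ^ 2) ≤ 2 * (∫ r in Set.Ioi (0:ℝ), w r ^ 2 * r)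
      ∧ ∫ r in Set.Ioi (0:ℝ), χ ((r - ρ) / R) ^ 2 * (w r ^ 2 * r)
        ≤ 2 * (ρ * ∫ r, (χ ((r - ρ) / R) * w r) ^ 2)
      ∧ ∫ r in Set.Ioi (0:ℝ), χ ((r - ρ) / R) ^ 2 * (w r ^ 2 * r)
        ≤ ∫ r in Set.Ioi (0:ℝ), w r ^ 2 * r := by
  obtain ⟨hV1, hV2, -, -⟩ := hχ.mul_localized hR hRρ hw
  have i2 : Integrable fun r => (χ ((r - ρ) / R) * w r) ^ 2 := by
    refine (hV1.continuous.pow 2).integrable_of_hasCompactSupport ?_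
    simpa only [pow_two] using hV2.mul_right (f' := fun r => χ ((r - ρ) / R) * w r)
  have hκ2 : ∀ r, χ ((r - ρ) / R) ^ 2 ≤ 1 := fun r =>
    pow_le_one₀ (hχ.mem_Icc _).1 (hχ.mem_Icc _).2
  have hcχ : Continuous fun r => χ ((r - ρ) / R) :=
    hχ.continuous.comp ((continuous_id.sub continuous_const).div_const R)
  have i3 : IntegrableOn (fun r => χ ((r - ρ) / R) ^ 2 * (w r ^ 2 * r)) (Set.Ioi 0) :=
    hE.bdd_mul (c := 1) (hcχ.pow 2).aestronglyMeasurable (ae_of_all _ fun r => by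
      rw [Real.norm_of_nonneg (sq_nonneg _)]; exact hκ2 r)
  have s2 : ∫ r in Set.Ioi (0:ℝ), (χ ((r - ρ) / R) * w r) ^ 2
      = ∫ r, (χ ((r - ρ) / R) * w r) ^ 2 :=
    setIntegral_eq_integral_of_forall_compl_eq_zero fun r hr => by
      have h0 : r ≤ 0 := not_lt.1 hr
      rw [hχ.eq_zero hR (IsCutoff.far_of_lt_half hRρ (by linarith))]; ring
  have near : ∀ r, χ ((r - ρ) / R) = 0 ∨ ρ ≤ 2 * r ∧ r ≤ 2 * ρ := fun r => by
    by_cases h : 3 * R ≤ |r - ρ|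
    · exact Or.inl (hχ.eq_zero hR h)
    · obtain ⟨h1, h2⟩ := IsCutoff.le_two_mul hRρ h
      exact Or.inr ⟨by linarith, h2⟩
  rw [← s2, ← integral_const_mul, ← integral_const_mul, ← integral_const_mul]
  refine ⟨?_, ?_, ?_⟩
  · refine setIntegral_mono_on (i2.integrableOn.const_mul ρ) (hE.const_mul 2) measurableSet_Ioi
      fun r (hr : 0 < r) => ?_
    have hwr : 0 ≤ w r ^ 2 * r := by positivity
    rcases near r with h | h
    · rw [h]; linarith
    · calc ρ * (χ ((r - ρ) / R) * w r) ^ 2 = χ ((r - ρ) / R) ^ 2 * (ρ * w r ^ 2) := by ring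
        _ ≤ 1 * (2 * r * w r ^ 2) :=
          mul_le_mul (hκ2 r) (mul_le_mul_of_nonneg_right h.1 (sq_nonneg _))
            (mul_nonneg (by linarith) (sq_nonneg _)) zero_le_one
        _ = _ := by ring
  · refine setIntegral_mono_on i3 ((i2.integrableOn.const_mul ρ).const_mul 2) measurableSet_Ioi
      fun r (hr : 0 < r) => ?_
    rcases near r with h | h
    · rw [h]; simp
    · calc χ ((r - ρ) / R) ^ 2 * (w r ^ 2 * r) = (χ ((r - ρ) / R) * w r) ^ 2 * r := by ring
        _ ≤ (χ ((r - ρ) / R) * w r) ^ 2 * (2 * ρ) :=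
          mul_le_mul_of_nonneg_left h.2 (sq_nonneg _)
        _ = _ := by ring
  · exact setIntegral_mono_on i3 hE measurableSet_Ioi fun r (hr : 0 < r) =>
      mul_le_of_le_one_left (by positivity) (hκ2 r)

lemma combine_localized_bounds {X R E Z Y ρN ρS μ K C₁ C₂ C₃ ω : ℝ} (hR : 8 ≤ R)
    (hμ : 0 ≤ μ) (hK : 0 ≤ K) (hC₁ : 0 ≤ C₁) (hC₃ : 0 ≤ C₃) (hE : 0 ≤ E)
    (hZ : 0 ≤ Z) (hZE : Z ≤ E) (hZY : Z ≤ 2 * Y) (hYE : Y ≤ 2 * E)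
    (hX : (1 - 4 / R) * ρN - C₁ / R * Y + ω / 2 * (E - Z) - C₂ / R * E ≤ X)
    (hN : μ * Y - K * ρS ≤ ρN) (hS : ρS ≤ C₃ / R ^ 2 * E) :
    (min (μ / 4) (ω / 2) - (2 * C₁ + C₂ + K * C₃) / R) * E ≤ X := by
  have hR0 : 0 < R := by linarith
  have hY : 0 ≤ Y := by linarith
  have h1 : 4 / R ≤ 1 / 2 := by rw [div_le_iff₀ hR0]; linarith
  have h2 : 0 ≤ 4 / R := by positivity
  have h3 : K * ρS ≤ K * C₃ / R * E := by
    calc K * ρS ≤ K * (C₃ / R ^ 2 * E) := mul_le_mul_of_nonneg_left hS hK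
      _ ≤ K * (C₃ / R * E) := by
        gcongr
        rw [sq]
        exact le_mul_of_one_le_right hR0.le (by linarith)
      _ = _ := by ring
  have h4 : 0 ≤ K * C₃ / R * E := by positivity
  have h5 : (1 - 4 / R) * (μ * Y - K * C₃ / R * E) ≤ (1 - 4 / R) * ρN :=
    mul_le_mul_of_nonneg_left (by linarith) (by linarith)
  have h6 : 1 / 2 * (μ * Y) ≤ (1 - 4 / R) * (μ * Y) :=
    mul_le_mul_of_nonneg_right (by linarith) (mul_nonneg hμ hY)
  have h7 : (1 - 4 / R) * (K * C₃ / R * E) ≤ K * C₃ / R * E :=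
    mul_le_of_le_one_left h4 (by linarith)
  have h8 : C₁ / R * Y ≤ C₁ / R * (2 * E) := mul_le_mul_of_nonneg_left hYE (by positivity)
  have h9 : μ / 4 * Z ≤ μ / 4 * (2 * Y) := mul_le_mul_of_nonneg_left hZY (by positivity)
  have h10 : min (μ / 4) (ω / 2) * Z ≤ μ / 4 * Z :=
    mul_le_mul_of_nonneg_right (min_le_left _ _) hZ
  have h11 : min (μ / 4) (ω / 2) * (E - Z) ≤ ω / 2 * (E - Z) :=
    mul_le_mul_of_nonneg_right (min_le_right _ _) (by linarith)
  have h12 : (2 * C₁ + C₂ + K * C₃) / R * E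
      = C₁ / R * (2 * E) + C₂ / R * E + K * C₃ / R * E := by ring
  rw [sub_mul, h12]
  linarith

lemma translation_source_eq {χ : ℝ → ℝ} (hχ : IsCutoff χ) {p c : ℝ} (hp : 1 < p) (hc : 0 < c)
    (l D ρ r : ℝ) :
    -(deriv (fun t => χ ((t - ρ) / l) * Qc p c (t - ρ)) r)
        - D * χ ((r - ρ) / l) * dQc p c (r - ρ)
      = ((p + 1) * c / 2) ^ (1 / (p - 1)) * √c
        * (χ ((r - ρ) / l) * (sech ((p - 1) * √c / 2 * (r - ρ)) ^ (2 / (p - 1))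
            * Real.tanh ((p - 1) * √c / 2 * (r - ρ)))
          - deriv χ ((r - ρ) / l) / l / √c * sech ((p - 1) * √c / 2 * (r - ρ)) ^ (2 / (p - 1))
          - D / √c * χ ((r - ρ) / l) * sech ((p - 1) * √c / 2 * (r - ρ)) ^ (2 / (p - 1))
            * (1 / ((p - 1) * c)
              - (r - ρ) * Real.tanh ((p - 1) * √c / 2 * (r - ρ)) * (1 / (2 * √c)))) := by
  have hp1 : p - 1 ≠ 0 := by linarith
  have hs : √c ≠ 0 := (Real.sqrt_pos.2 hc).ne'
  have h1 : HasDerivAt (fun t => Qc p c (t - ρ)) _ r :=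
    (hasDerivAt_Qc p c (r - ρ)).comp_sub_const r ρ
  rw [((hχ.hasDerivAt_comp ρ l r).fun_mul h1).deriv, dQc_eq hp hc, Qc_eq]
  have e : 2 / (p - 1) * ((p - 1) * √c / 2) = √c := by field_simp
  generalize ((p + 1) * c / 2) ^ (1 / (p - 1)) = A
  generalize sech ((p - 1) * √c / 2 * (r - ρ)) ^ (2 / (p - 1)) = S
  generalize Real.tanh ((p - 1) * √c / 2 * (r - ρ)) = T
  generalize deriv χ ((r - ρ) / l) = δ
  rw [mul_assoc A (2 / (p - 1)), e]
  field_simp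
  ring

lemma continuous_Qc (p c : ℝ) : Continuous (Qc p c) :=
  continuous_iff_continuousAt.2 fun x => (hasDerivAt_Qc p c x).continuousAt

lemma integrableOn_energy {w f : ℝ → ℝ} {ω ε B : ℝ} (hw : ContDiffOn ℝ 1 w (Set.Ioi 0))
    (hI : IntegrableOn
      (fun r => (deriv w r ^ 2 + w r ^ 2 + (r ^ 2)⁻¹ * w r ^ 2) * r) (Set.Ioi 0))
    (hf : Continuous f) (hf0 : ∀ r, 0 ≤ f r) (hfB : ∀ r, f r ≤ B) :
    IntegrableOn (fun r => (deriv w r ^ 2 + (ω + ((ε * r) ^ 2)⁻¹) * w r ^ 2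
      - f r * w r ^ 2) * r) (Set.Ioi 0) := by
  obtain ⟨h1, h2, h3⟩ := integrableOn_of_energy hw hI
  have h4 : IntegrableOn (fun r => f r * (w r ^ 2 * r)) (Set.Ioi 0) :=
    h2.bdd_mul (c := B) hf.aestronglyMeasurable (ae_of_all _ fun r => by
      rw [Real.norm_of_nonneg (hf0 r)]; exact hfB r)
  refine (((h1.add (h2.const_mul ω)).add (h3.const_mul (ε ^ 2)⁻¹)).sub h4).congr
    (ae_of_all _ fun r => ?_)
  simp only [Pi.add_apply, Pi.sub_apply, mul_pow, mul_inv]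
  ring

/-- The coercivity estimate with explicit error, on the window of radius `2 * R` about `ρ`. -/
lemma energy_lower_bound {p ω : ℝ} (hp : 1 < p) (hω : 0 < ω) {μ K : ℝ} (hμ : 0 < μ) (hK : 0 < K)
    (hPT : ∀ β > 0, ∀ ρ : ℝ, ∀ f : ℝ → ℝ, ContDiff ℝ 1 f → HasCompactSupport f →
      μ * β ^ 2 * (∫ r, f r ^ 2)
        - K * β ^ 3 * ((∫ r, f r * sech (β * (r - ρ)) ^ (2 / (p - 1) + 1)) ^ 2
          + (∫ r, f r * (sech (β * (r - ρ)) ^ (2 / (p - 1)) * Real.tanh (β * (r - ρ)))) ^ 2)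
      ≤ ∫ r, (deriv f r ^ 2 + β ^ 2 * ((2 / (p - 1)) ^ 2
          - (2 / (p - 1) + 1) * (2 / (p - 1) + 2) * sech (β * (r - ρ)) ^ 2) * f r ^ 2))
    {χ : ℝ → ℝ} (hχ : IsCutoff χ) {M : ℝ} (hM : ∀ s, |deriv χ s| ≤ M)
    {ε ρ c c₁ l D₁ R : ℝ} (hε : 0 < ε) (hcρ : c = ω + ((ε * ρ) ^ 2)⁻¹) (hcc₁ : c ≤ c₁)
    (hD : 2 * ε * ((ε * ρ) ^ 3)⁻¹ ≤ D₁ / R) (hR : 8 ≤ R)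
    (hRω : (2 / (p - 1) + 1) * (2 / (p - 1) + 2) ≤ ω * R) (hR2 : R ^ 2 ≤ ρ)
    (hRρ : 3 * R ≤ ρ / 2) (hRl : R ≤ l) (hlρ : 3 * l ≤ ρ / 2) {Φ Ψ w : ℝ → ℝ}
    (hΦ : ∀ r : ℝ, Φ r = χ ((r - ρ) / l) * Qc p c (r - ρ))
    (hΨ : ∀ r : ℝ, Ψ r = -(deriv (fun t => χ ((t - ρ) / l) * Qc p c (t - ρ)) r)
        - 2 * ε * ((ε * ρ) ^ 3)⁻¹ * χ ((r - ρ) / l) * dQc p c (r - ρ))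
    (hw : ContDiffOn ℝ 1 w (Set.Ioi 0))
    (hI : IntegrableOn
        (fun r => (deriv w r ^ 2 + w r ^ 2 + (r ^ 2)⁻¹ * w r ^ 2) * r) (Set.Ioi 0))
    (hΨ0 : (∫ r in Set.Ioi (0:ℝ), w r * Ψ r * r) = 0)
    (hΦ0 : (∫ r in Set.Ioi (0:ℝ), w r * Φ r ^ ((p + 1) / 2) * r) = 0) :
    (min (μ * ((p - 1) * √ω / 2) ^ 2 / 4) (ω / 2)
      - (2 * (15 * c₁ + 7 * (((p - 1) * √c₁ / 2) ^ 2
          * ((2 / (p - 1) + 1) * (2 / (p - 1) + 2)))) + M ^ 2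
        + K * ((p - 1) * √c₁ / 2) ^ 3
          * ((2 * 2 ^ 2 + 2 * (2 + 2 * M / √ω
            + 2 * D₁ / √ω * (1 / ((p - 1) * ω) + 1 / (2 * √ω))) ^ 2)
            * ∫ x, ((1 + |x|) * sech ((p - 1) * √ω / 2 * x) ^ (2 / (p - 1))) ^ 2)) / R)
      * (∫ r in Set.Ioi (0:ℝ), w r ^ 2 * r)
      ≤ ∫ r in Set.Ioi (0:ℝ),
          (deriv w r ^ 2 + (ω + ((ε * r) ^ 2)⁻¹) * w r ^ 2
            - p * Φ r ^ (p - 1) * w r ^ 2) * r := by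
  have hp1 : 0 < p - 1 := by linarith
  have hR0 : 0 < R := by linarith
  have hl0 : 0 < l := by linarith
  have hρ : 0 < ρ := by linarith
  have hωc : ω ≤ c := by
    have : 0 ≤ ((ε * ρ) ^ 2)⁻¹ := by positivity
    linarith
  have hc : 0 < c := by linarith
  have hsω : 0 < √ω := Real.sqrt_pos.2 hω
  have hsc : 0 < √c := Real.sqrt_pos.2 hc
  have hsωc : √ω ≤ √c := Real.sqrt_le_sqrt hωc
  have hscc : √c ≤ √c₁ := Real.sqrt_le_sqrt hcc₁
  obtain ⟨m, hm⟩ : ∃ m, m = 2 / (p - 1) := ⟨_, rfl⟩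
  obtain ⟨β, hβ⟩ : ∃ β, β = (p - 1) * √c / 2 := ⟨_, rfl⟩
  obtain ⟨β₀, hβ₀⟩ : ∃ β₀, β₀ = (p - 1) * √ω / 2 := ⟨_, rfl⟩
  obtain ⟨β₁, hβ₁⟩ : ∃ β₁, β₁ = (p - 1) * √c₁ / 2 := ⟨_, rfl⟩
  obtain ⟨q, hq⟩ : ∃ q : ℝ → ℝ, ∀ r, q r = p * Qc p c (r - ρ) ^ (p - 1) := ⟨_, fun _ => rfl⟩
  have hqs : ∀ r, q r = β ^ 2 * ((m + 1) * (m + 2) * sech (β * (r - ρ)) ^ 2) := fun r => by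
    rw [hq, mul_Qc_rpow_sub_one hp hc, hβ, hm]
  have hm0 : 0 < m := by rw [hm]; positivity
  have hβ₀0 : 0 < β₀ := by rw [hβ₀]; positivity
  have hββ₀ : β₀ ≤ β := by rw [hβ, hβ₀]; gcongr
  have hββ₁ : β ≤ β₁ := by rw [hβ, hβ₁]; gcongr
  have hβ0 : 0 < β := by linarith
  have hmβ : β ^ 2 * m ^ 2 = c := by
    rw [hβ, hm, ← mul_pow]
    calc ((p - 1) * √c / 2 * (2 / (p - 1))) ^ 2 = √c ^ 2 := by congr 1; field_simp
      _ = c := Real.sq_sqrt hc.le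
  rw [← hβ₀, ← hβ₁, ← hm]
  rw [← hm] at hRω
  obtain ⟨-, hE, -⟩ := integrableOn_of_energy hw hI
  have hqc : Continuous q := by
    rw [show q = fun r => β ^ 2 * ((m + 1) * (m + 2) * sech (β * (r - ρ)) ^ 2) from funext hqs]
    exact continuous_const.mul (continuous_const.mul
      ((continuous_comp_shift continuous_sech β ρ).pow 2))
  have hs1 : ∀ x, sech x ^ 2 ≤ 1 := fun x => pow_le_one₀ (sech_pos _).le (sech_le_one _)
  have hq0 : ∀ r, 0 ≤ q r := fun r => by rw [hqs]; positivity
  have hqB : ∀ r, q r ≤ β₁ ^ 2 * ((m + 1) * (m + 2)) := fun r => by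
    rw [hqs]
    have := hs1 (β * (r - ρ))
    calc β ^ 2 * ((m + 1) * (m + 2) * sech (β * (r - ρ)) ^ 2)
        ≤ β₁ ^ 2 * ((m + 1) * (m + 2) * 1) := by gcongr
      _ = _ := by ring
  have hfar : ∀ r, 2 * R < |r - ρ| → q r ≤ ω / 2 := fun r hr => by
    have h1 := sech_sq_mul_sq_le (β * (r - ρ))
    have h2 : q r * (r - ρ) ^ 2 ≤ (m + 1) * (m + 2) := by
      rw [hqs]
      calc β ^ 2 * ((m + 1) * (m + 2) * sech (β * (r - ρ)) ^ 2) * (r - ρ) ^ 2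
          = (m + 1) * (m + 2) * (sech (β * (r - ρ)) ^ 2 * (β * (r - ρ)) ^ 2) := by ring
        _ ≤ (m + 1) * (m + 2) * 1 := by gcongr
        _ = _ := mul_one _
    have h3 : 2 * R ≤ (r - ρ) ^ 2 := by
      rw [← sq_abs]
      nlinarith
    have h4 : q r * (2 * R) ≤ ω / 2 * (2 * R) :=
      calc q r * (2 * R) ≤ q r * (r - ρ) ^ 2 := mul_le_mul_of_nonneg_left h3 (hq0 r)
        _ ≤ ω * R := h2.trans hRω
        _ = _ := by ring
    exact le_of_mul_le_mul_right h4 (by linarith)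
  have hΦ0' : ∀ r, 0 ≤ Φ r := fun r => by
    rw [hΦ]; exact mul_nonneg (hχ.mem_Icc _).1 (Qc_pos hp hc _).le
  have hfq : ∀ r, p * Φ r ^ (p - 1) ≤ q r := fun r => by
    rw [hq]
    refine mul_le_mul_of_nonneg_left (Real.rpow_le_rpow (hΦ0' r) ?_ hp1.le) (by linarith)
    rw [hΦ]
    exact mul_le_of_le_one_left (Qc_pos hp hc _).le (hχ.mem_Icc _).2
  have hΦc : Continuous Φ := by
    rw [show Φ = fun r => χ ((r - ρ) / l) * Qc p c (r - ρ) from funext hΦ]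
    exact (hχ.continuous.comp ((continuous_id.sub continuous_const).div_const l)).mul
      ((continuous_Qc p c).comp (continuous_id.sub continuous_const))
  have hen := integrableOn_energy (ω := ω) (ε := ε) (f := fun r => p * Φ r ^ (p - 1)) hw hI
    (continuous_const.mul (hΦc.rpow_const fun _ => Or.inr hp1.le))
    (fun r => mul_nonneg (by linarith) (Real.rpow_nonneg (hΦ0' r) _))
    (fun r => (hfq r).trans (hqB r))
  have hX := integral_energy_ge (ω := ω) (W := fun r => ω + ((ε * r) ^ 2)⁻¹) hχ hR hR2 hRρ hc hM
    hw hE hen (fun r _ => le_add_of_nonneg_right (by positivity)) (fun r hr => by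
      have e : ((ε * r) ^ 2)⁻¹ = ((ε * ρ) ^ 2)⁻¹ * (ρ / r) ^ 2 := by field_simp
      rcases le_total ((ρ / r) ^ 2) 1 with h | h
      · left
        rw [e]
        have : ((ε * ρ) ^ 2)⁻¹ * (1 - (ρ / r) ^ 2) ≤ c * (1 - (ρ / r) ^ 2) :=
          mul_le_mul_of_nonneg_right (by linarith) (by linarith)
        linarith
      · right
        rw [e, hcρ]
        have : ((ε * ρ) ^ 2)⁻¹ ≤ ((ε * ρ) ^ 2)⁻¹ * (ρ / r) ^ 2 :=
          le_mul_of_one_le_right (by positivity) h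
        linarith) (fun r _ => hfq r) hqc hq0 hqB hfar
  obtain ⟨hV1, hV2, -, -⟩ := hχ.mul_localized hR0 hRρ hw
  have hN := hPT β hβ0 ρ _ hV1 hV2
  rw [← hm] at hN
  have hNq : ∀ r, β ^ 2 * (m ^ 2 - (m + 1) * (m + 2) * sech (β * (r - ρ)) ^ 2) = c - q r :=
    fun r => by rw [hqs, ← hmβ]; ring
  simp only [hNq] at hN
  obtain ⟨b1, b2, b3⟩ := localized_mass_bounds hχ hR0 hRρ hw hE
  have hA : ((p + 1) * c / 2) ^ (1 / (p - 1)) ≠ 0 := (Real.rpow_pos_of_pos (by positivity) _).ne'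
  have hs : ρ * (∫ r, χ ((r - ρ) / R) * w r * sech (β * (r - ρ)) ^ (m + 1)) ^ 2
      ≤ 2 * 2 ^ 2 / R ^ 2 * (∫ x, ((1 + |x|) * sech (β₀ * x) ^ m) ^ 2)
        * ∫ r in Set.Ioi (0:ℝ), w r ^ 2 * r := by
    refine sq_sech_mode_le (q := (p + 1) / 2) hχ (by linarith) hRρ hRl hlρ hm0 hβ₀0 hββ₀
      (by linarith) hw hE ?_
    have hA' : (((p + 1) * c / 2) ^ (1 / (p - 1))) ^ ((p + 1) / 2) ≠ 0 :=
      (Real.rpow_pos_of_pos (Real.rpow_pos_of_pos (by positivity) _) _).ne'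
    refine (mul_eq_zero.1 ?_).resolve_left hA'
    rw [← integral_const_mul]
    refine Eq.trans ?_ hΦ0
    congr 1
    funext r
    rw [hΦ, Real.mul_rpow (hχ.mem_Icc _).1 (Qc_pos hp hc _).le, Qc_rpow_half hp hc, hβ, hm]
    ring
  have ht : ρ * (∫ r, χ ((r - ρ) / R) * w r
        * (sech (β * (r - ρ)) ^ m * Real.tanh (β * (r - ρ)))) ^ 2
      ≤ 2 * (2 + 2 * M / √ω + 2 * D₁ / √ω * (1 / ((p - 1) * ω) + 1 / (2 * √ω))) ^ 2 / R ^ 2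
        * (∫ x, ((1 + |x|) * sech (β₀ * x) ^ m) ^ 2)
        * ∫ r in Set.Ioi (0:ℝ), w r ^ 2 * r := by
    refine sq_tanh_mode_le (n := √c) (a := 1 / ((p - 1) * c)) (b := 1 / (2 * √c))
      (D := 2 * ε * ((ε * ρ) ^ 3)⁻¹) hχ (by linarith) hRρ hRl hlρ hm0 hβ₀0 hββ₀ hM hsω hsωc
      (by positivity) (by gcongr) (by positivity) (by gcongr) (by positivity) hD hw hE ?_
    refine (mul_eq_zero.1 ?_).resolve_left (mul_ne_zero hA hsc.ne')
    rw [← integral_const_mul]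
    refine Eq.trans ?_ hΨ0
    congr 1
    funext r
    rw [hΨ, translation_source_eq hχ hp hc, hβ, hm]
    ring
  have hH : 0 ≤ ∫ x, ((1 + |x|) * sech (β₀ * x) ^ m) ^ 2 := integral_nonneg fun x => sq_nonneg _
  have hc₁ : 0 < c₁ := by linarith
  have hβ₁0 : 0 < β₁ := by linarith
  set E := ∫ r in Set.Ioi (0:ℝ), w r ^ 2 * r
  set H := ∫ x, ((1 + |x|) * sech (β₀ * x) ^ m) ^ 2
  set a := ∫ r, χ ((r - ρ) / R) * w r * sech (β * (r - ρ)) ^ (m + 1)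
  set b := ∫ r, χ ((r - ρ) / R) * w r * (sech (β * (r - ρ)) ^ m * Real.tanh (β * (r - ρ)))
  set y := ∫ r, (χ ((r - ρ) / R) * w r) ^ 2
  set N := ∫ r, (deriv (fun r => χ ((r - ρ) / R) * w r) r ^ 2
    + (c - q r) * (χ ((r - ρ) / R) * w r) ^ 2)
  set Cb := 2 + 2 * M / √ω + 2 * D₁ / √ω * (1 / ((p - 1) * ω) + 1 / (2 * √ω))
  have hE0 : 0 ≤ E :=
    setIntegral_nonneg measurableSet_Ioi fun r hr => mul_nonneg (sq_nonneg _) (le_of_lt hr)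
  have hZ0 : 0 ≤ ∫ r in Set.Ioi (0:ℝ), χ ((r - ρ) / R) ^ 2 * (w r ^ 2 * r) :=
    setIntegral_nonneg measurableSet_Ioi fun r hr =>
      mul_nonneg (sq_nonneg _) (mul_nonneg (sq_nonneg _) (le_of_lt hr))
  have hy : 0 ≤ y := integral_nonneg fun r => sq_nonneg _
  have hN' : μ * β₀ ^ 2 * (ρ * y) - K * β₁ ^ 3 * (ρ * (a ^ 2 + b ^ 2)) ≤ ρ * N := by
    have n1 : μ * β₀ ^ 2 * y ≤ μ * β ^ 2 * y := by gcongr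
    have n2 : K * β ^ 3 * (a ^ 2 + b ^ 2) ≤ K * β₁ ^ 3 * (a ^ 2 + b ^ 2) := by gcongr
    calc μ * β₀ ^ 2 * (ρ * y) - K * β₁ ^ 3 * (ρ * (a ^ 2 + b ^ 2))
        = ρ * (μ * β₀ ^ 2 * y - K * β₁ ^ 3 * (a ^ 2 + b ^ 2)) := by ring
      _ ≤ ρ * N := mul_le_mul_of_nonneg_left (by linarith) hρ.le
  refine combine_localized_bounds hR (by positivity) (by positivity) (by positivity)
    (by positivity) hE0 hZ0 b3 b2 b1 ?_ hN' ?_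
  · refine le_trans ?_ hX
    have : (15 * c + 7 * (β₁ ^ 2 * ((m + 1) * (m + 2)))) / R * (ρ * y)
        ≤ (15 * c₁ + 7 * (β₁ ^ 2 * ((m + 1) * (m + 2)))) / R * (ρ * y) := by gcongr
    linarith
  · calc ρ * (a ^ 2 + b ^ 2) = ρ * a ^ 2 + ρ * b ^ 2 := by ring
      _ ≤ 2 * 2 ^ 2 / R ^ 2 * H * E + 2 * Cb ^ 2 / R ^ 2 * H * E := add_le_add hs ht
      _ = _ := by ring

lemma exists_scale {a b c₀ : ℝ} (R k : ℝ) (ha : 0 < a) (hb : 0 < b) :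
    ∃ ε₀ > 0, ∀ ε ∈ Set.Ioo (0:ℝ) ε₀, ε < 1 ∧ R * ε ≤ 1 ∧ R ^ 2 * ε ≤ a ∧ 3 * R * ε ≤ a
      ∧ c₀ ≤ b * -Real.log ε ∧ k * -Real.log ε * ε ≤ a := by
  have hid : Tendsto (fun ε : ℝ => ε) (nhdsWithin 0 (Set.Ioi 0)) (nhds 0) :=
    tendsto_nhdsWithin_of_tendsto_nhds tendsto_id
  have hlin : ∀ C d : ℝ, 0 < d → ∀ᶠ ε : ℝ in nhdsWithin 0 (Set.Ioi 0), C * ε ≤ d := by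
    intro C d hd
    have h := hid.const_mul C
    rw [mul_zero] at h
    exact h.eventually_le_const hd
  have hlog : ∀ᶠ ε : ℝ in nhdsWithin 0 (Set.Ioi 0), c₀ ≤ b * -Real.log ε :=
    ((tendsto_neg_atBot_atTop.comp Real.tendsto_log_nhdsGT_zero).const_mul_atTop
      hb).eventually_ge_atTop c₀
  have hmul : ∀ᶠ ε : ℝ in nhdsWithin 0 (Set.Ioi 0), k * -Real.log ε * ε ≤ a := by
    have h := (tendsto_log_mul_rpow_nhdsGT_zero one_pos).const_mul (-k)
    rw [mul_zero] at h
    filter_upwards [h.eventually_le_const ha] with ε hε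
    rw [Real.rpow_one] at hε
    linarith
  have hall := (hid.eventually_lt_const one_pos).and ((hlin R 1 one_pos).and
    ((hlin (R ^ 2) a ha).and ((hlin (3 * R) a ha).and (hlog.and hmul))))
  obtain ⟨ε₀, h0, hsub⟩ := mem_nhdsGT_iff_exists_Ioo_subset.1 hall
  exact ⟨ε₀, h0, fun ε hε => hsub hε⟩

theorem stmt13 (p ω : ℝ) (hp : 1 < p) (hω : 0 < ω)
    (α₀ : ℝ) (hα : α₀ = 2 / Real.sqrt ((p - 1) * ω))
    (χ : ℝ → ℝ) (hχsmooth : ContDiff ℝ (⊤ : ℕ∞) χ) (hχrange : ∀ s, χ s ∈ Set.Icc (0:ℝ) 1)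
    (hχone : ∀ s ∈ Set.Icc (-2:ℝ) 2, χ s = 1)
    (hχzero : ∀ s ∉ Set.Ioo (-3:ℝ) 3, χ s = 0) :
    ∃ εstar > (0:ℝ), ∃ c₁ > (0:ℝ),
      ∀ ε ∈ Set.Ioo (0:ℝ) εstar, ∀ ρ ∈ Set.Ioo (α₀ / (2 * ε)) (2 * α₀ / ε),
      ∀ c l : ℝ, c = ω + ((ε * ρ) ^ 2)⁻¹ →
      l = -(2 / Real.sqrt c) * max 1 (1 / (p - 1)) * Real.log ε →
      ∀ Φ Ψ : ℝ → ℝ,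
      (∀ r : ℝ, Φ r = χ ((r - ρ) / l) * Qc p c (r - ρ)) →
      (∀ r : ℝ, Ψ r = -(deriv (fun t => χ ((t - ρ) / l) * Qc p c (t - ρ)) r)
        - 2 * ε * ((ε * ρ) ^ 3)⁻¹ * χ ((r - ρ) / l) * dQc p c (r - ρ)) →
      ∀ w : ℝ → ℝ, ContDiffOn ℝ 1 w (Set.Ioi 0) →
      IntegrableOn
        (fun r => (deriv w r ^ 2 + w r ^ 2 + (r ^ 2)⁻¹ * w r ^ 2) * r) (Set.Ioi 0) →
      (∫ r in Set.Ioi (0:ℝ), w r * Ψ r * r) = 0 →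
      (∫ r in Set.Ioi (0:ℝ), w r * Φ r ^ ((p + 1) / 2) * r) = 0 →
      (∫ r in Set.Ioi (0:ℝ),
          (deriv w r ^ 2 + (ω + ((ε * r) ^ 2)⁻¹) * w r ^ 2
            - p * Φ r ^ (p - 1) * w r ^ 2) * r)
        ≥ c₁ * ∫ r in Set.Ioi (0:ℝ), w r ^ 2 * r := by
  have hp1 : 0 < p - 1 := by linarith
  have hα0 : 0 < α₀ := by
    rw [hα]
    have : 0 < (p - 1) * ω := by positivity
    positivity
  have hcut : IsCutoff χ := ⟨hχsmooth, hχrange, hχone, hχzero⟩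
  obtain ⟨M, hM⟩ := hcut.exists_deriv_bound
  obtain ⟨μ, hμ, K, hK, hPT⟩ := poschlTeller_coercive_scaled (m := 2 / (p - 1)) (by positivity)
  obtain ⟨C, hC⟩ : ∃ C, C = ω + 4 / α₀ ^ 2 := ⟨_, rfl⟩
  obtain ⟨err, herr⟩ : ∃ err, err = 2 * (15 * C + 7 * (((p - 1) * √C / 2) ^ 2
          * ((2 / (p - 1) + 1) * (2 / (p - 1) + 2)))) + M ^ 2
        + K * ((p - 1) * √C / 2) ^ 3
          * ((2 * 2 ^ 2 + 2 * (2 + 2 * M / √ω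
            + 2 * (16 / α₀ ^ 3) / √ω * (1 / ((p - 1) * ω) + 1 / (2 * √ω))) ^ 2)
            * ∫ x, ((1 + |x|) * sech ((p - 1) * √ω / 2 * x) ^ (2 / (p - 1))) ^ 2) := ⟨_, rfl⟩
  obtain ⟨δ, hδ⟩ : ∃ δ, δ = min (μ * ((p - 1) * √ω / 2) ^ 2 / 4) (ω / 2) := ⟨_, rfl⟩
  have hδ0 : 0 < δ := by
    have := Real.sqrt_pos.2 hω
    rw [hδ]
    exact lt_min (by positivity) (by positivity)
  obtain ⟨R, hR⟩ : ∃ R, R = max (max 8 ((2 / (p - 1) + 1) * (2 / (p - 1) + 2) / ω))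
    (2 * err / δ) := ⟨_, rfl⟩
  have hR8 : 8 ≤ R := by rw [hR]; exact (le_max_left _ _).trans (le_max_left _ _)
  have hR0 : 0 < R := by linarith
  have hRω : (2 / (p - 1) + 1) * (2 / (p - 1) + 2) ≤ ω * R := by
    rw [← div_le_iff₀' hω, hR]; exact (le_max_right _ _).trans (le_max_left _ _)
  have hRδ : err / R ≤ δ / 2 := by
    have : 2 * err / δ ≤ R := by rw [hR]; exact le_max_right _ _
    rw [div_le_iff₀ hδ0] at this
    rw [div_le_iff₀ hR0]
    linarith
  have hC0 : 0 < C := by rw [hC]; positivity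
  have hsC : 0 < √C := Real.sqrt_pos.2 hC0
  have hsω : 0 < √ω := Real.sqrt_pos.2 hω
  obtain ⟨ε₀, hε₀, hsmall⟩ := exists_scale (a := α₀ / 4) (b := 2 / √C) (c₀ := R) R
    (3 * (2 / √ω * max 1 (1 / (p - 1)))) (by positivity) (by positivity)
  refine ⟨ε₀, hε₀, δ / 2, by positivity, ?_⟩
  intro ε hε ρ hρ c l hc hl Φ Ψ hΦ hΨ w hw hI hΨ0 hΦ0
  obtain ⟨s1, s2, s3, s4, s5, s6⟩ := hsmall ε hε
  have hε0 : 0 < ε := hε.1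
  have hρ1 : α₀ / 2 < ε * ρ := by
    have := hρ.1
    rw [div_lt_iff₀ (by positivity)] at this
    linarith
  have hρ0 : 0 < ρ := pos_of_mul_pos_right (by linarith : 0 < ε * ρ) hε0.le
  have hlarge : ∀ x, x * ε ≤ α₀ / 4 → x ≤ ρ / 2 := fun x hx =>
    le_of_mul_le_mul_right (by linarith : x * ε ≤ ρ / 2 * ε) hε0
  have hcC : c ≤ C := by
    rw [hc, hC]
    gcongr
    calc ((ε * ρ) ^ 2)⁻¹ ≤ ((α₀ / 2) ^ 2)⁻¹ := by gcongr
      _ = 4 / α₀ ^ 2 := by field_simp; norm_num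
  have hωc : ω ≤ c := by
    rw [hc]; exact le_add_of_nonneg_right (by positivity)
  have hsc : 0 < √c := Real.sqrt_pos.2 (hω.trans_le hωc)
  have hlog : 0 ≤ -Real.log ε := neg_nonneg.2 (Real.log_nonpos hε0.le s1.le)
  have hmax : 1 ≤ max 1 (1 / (p - 1)) := le_max_left _ _
  have hl' : l = 2 / √c * max 1 (1 / (p - 1)) * -Real.log ε := by rw [hl]; ring
  have hRl : R ≤ l := by
    refine s5.trans ?_
    rw [hl']
    refine mul_le_mul_of_nonneg_right ?_ hlog
    calc 2 / √C ≤ 2 / √c := by gcongr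
      _ ≤ _ := le_mul_of_one_le_right (by positivity) hmax
  have hlρ : 3 * l ≤ ρ / 2 := by
    refine le_trans ?_ (hlarge _ s6)
    rw [hl']
    calc 3 * (2 / √c * max 1 (1 / (p - 1)) * -Real.log ε)
        ≤ 3 * (2 / √ω * max 1 (1 / (p - 1)) * -Real.log ε) := by gcongr
      _ = _ := by ring
  have hD : 2 * ε * ((ε * ρ) ^ 3)⁻¹ ≤ 16 / α₀ ^ 3 / R := by
    have d1 : ((ε * ρ) ^ 3)⁻¹ ≤ 8 / α₀ ^ 3 := by
      calc ((ε * ρ) ^ 3)⁻¹ ≤ ((α₀ / 2) ^ 3)⁻¹ := by gcongr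
        _ = 8 / α₀ ^ 3 := by field_simp; norm_num
    have d2 : ε ≤ 1 / R := by rw [le_div_iff₀ hR0]; linarith
    calc 2 * ε * ((ε * ρ) ^ 3)⁻¹ ≤ 2 * (1 / R) * (8 / α₀ ^ 3) := by gcongr
      _ = _ := by ring
  have key := energy_lower_bound hp hω hμ hK hPT hcut hM hε0 hc hcC hD hR8 hRω
    ((hlarge _ s3).trans (by linarith)) (hlarge _ s4) hRl hlρ hΦ hΨ hw hI hΨ0 hΦ0
  rw [← herr, ← hδ] at key
  refine le_trans ?_ key
  refine mul_le_mul_of_nonneg_right (by linarith) ?_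
  exact setIntegral_nonneg measurableSet_Ioi fun r hr => mul_nonneg (sq_nonneg _) (le_of_lt hr)
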